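/- arXiv:2504.07259 — 6 statements merged into one kernel-verified Lean document; each statement's English description precedes it below -/
import Mathlib

section
/- Let H be a real Hilbert space and f : H → ℝ ∪ {+∞} a proper lower semicontinuous convex function. If x ∈ dom ∂f satisfies s_f(x) = inf_{y ∈ H} s_f(y) (i.e., x ∈ argmin s_f), then ∂°f(x) = p_f. Consequently, for any two points x, y ∈ argmin s_f one has f(y) − f(x) = ⟨p_f, y − x⟩; that is, f is affine on the (possibly empty) set argmin s_f. -/
open Set Filter MeasureTheory RealInnerProductSpace
open scoped ENNReal NNReal Classical

variable {H : Type*} [NormedAddCommGroup H] [InnerProductSpace ℝ H] [CompleteSpace H]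

/-- The convex subdifferential of an extended-real-valued function `f` at `x`. -/
def SubdiffE (f : H → EReal) (x : H) : Set H :=
  {p | ∀ y, f x + ((⟪p, y - x⟫ : ℝ) : EReal) ≤ f y}

/-- Convexity for extended-real-valued functions. -/
def ConvexE (f : H → EReal) : Prop :=
  ∀ x y : H, ∀ a b : ℝ, 0 ≤ a → 0 ≤ b → a + b = 1 →
    f (a • x + b • y) ≤ (a : EReal) * f x + (b : EReal) * f y

/-- The element of minimal norm of a set (defined when it exists, `0` otherwise).
For a nonempty closed convex subset of a Hilbert space this is the projection of `0`. -/
noncomputable def minNormElt (S : Set H) : H :=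
  if h : ∃ p ∈ S, ∀ q ∈ S, ‖p‖ ≤ ‖q‖ then h.choose else 0

/-- The slope of `f` at `x`: `dist(0, ∂f(x))`, with value `⊤` when `∂f(x) = ∅`. -/
noncomputable def slopeE (f : H → EReal) (x : H) : ℝ≥0∞ :=
  ⨅ p ∈ SubdiffE f x, (‖p‖₊ : ℝ≥0∞)

/-- `γ : [0,∞) → H` is the subgradient curve of `f` emanating from `x`:
a locally absolutely continuous curve with `γ 0 = x` and `γ' t ∈ -∂f(γ t)` a.e. -/
def IsSubgradientCurve (f : H → EReal) (x : H) (γ : ℝ → H) : Prop :=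
  γ 0 = x ∧ ContinuousOn γ (Set.Ici 0) ∧
  ∃ v : ℝ → H,
    (∀ t > 0, MeasureTheory.IntegrableOn v (Set.Ioc 0 t)) ∧
    (∀ t ≥ 0, γ t = x + ∫ s in Set.Ioc 0 t, v s) ∧
    (∀ᵐ t ∂(MeasureTheory.volume.restrict (Set.Ioi (0:ℝ))), -v t ∈ SubdiffE f (γ t))

omit [CompleteSpace H] in
theorem ConvexE.le_of_le {f : H → EReal} (hconv : ConvexE f) {u v : H} {r s a b : ℝ}
    (hu : f u ≤ r) (hv : f v ≤ s) (ha : 0 ≤ a) (hb : 0 ≤ b) (hab : a + b = 1) :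
    f (a • u + b • v) ≤ ((a * r + b * s : ℝ) : EReal) := by
  refine (hconv u v a b ha hb hab).trans ?_
  rw [EReal.coe_add, EReal.coe_mul, EReal.coe_mul]
  have ha' : (0 : EReal) ≤ a := by exact_mod_cast ha
  have hb' : (0 : EReal) ≤ b := by exact_mod_cast hb
  gcongr

omit [InnerProductSpace ℝ H] [CompleteSpace H] in
/-- A lower semicontinuous function is bounded at the limit of a sequence by the limit of
real upper bounds along the sequence. -/
theorem LowerSemicontinuous.le_of_tendsto_of_le {f : H → EReal} (hlsc : LowerSemicontinuous f)
    {z : ℕ → H} {a : H} {r : ℕ → ℝ} {ρ : ℝ} (hz : Tendsto z atTop (nhds a))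
    (hr : Tendsto r atTop (nhds ρ)) (h : ∀ n, f (z n) ≤ r n) : f a ≤ ρ := by
  by_contra! hlt
  obtain ⟨t, ht1, ht2⟩ := EReal.lt_iff_exists_real_btwn.1 hlt
  have h1 : ∀ᶠ n in atTop, (t : EReal) < f (z n) := hz.eventually (hlsc a t ht2)
  have h2 : ∀ᶠ n in atTop, r n < t := hr.eventually_lt_const (by exact_mod_cast ht1)
  obtain ⟨n, hn1, hn2⟩ := (h1.and h2).exists
  have h3 : (t : EReal) < r n := hn1.trans_le (h n)
  exact absurd (EReal.coe_lt_coe_iff.1 h3) hn2.le.not_gt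

/-- A proper lower semicontinuous convex function with an affine minorant attains the minimum of
its quadratic perturbation centred at any point. -/
theorem exists_minimizer_add_sq {f : H → EReal} (hlsc : LowerSemicontinuous f)
    (hconv : ConvexE f) {x₀ : H} {r₀ : ℝ} (hx₀ : f x₀ ≤ r₀) {m : H} {c : ℝ}
    (hminor : ∀ z, ((c + ⟪m, z⟫ : ℝ) : EReal) ≤ f z) {ε : ℝ} (hε : 0 < ε) :
    ∃ (z : H) (ρ : ℝ), f z ≤ ρ ∧ ∀ (w : H) (s : ℝ), f w ≤ s →
      ρ - ⟪m, z⟫ + ε * ‖z - x₀‖ ^ 2 ≤ s - ⟪m, w⟫ + ε * ‖w - x₀‖ ^ 2 := by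
  set S : Set ℝ := {t | ∃ (w : H) (s : ℝ), f w ≤ s ∧ t = s - ⟪m, w⟫ + ε * ‖w - x₀‖ ^ 2}
  have hne : S.Nonempty := ⟨_, x₀, r₀, hx₀, rfl⟩
  have hbdd : BddBelow S := by
    refine ⟨c, ?_⟩
    rintro t ⟨w, s, hs, rfl⟩
    have h1 : c + ⟪m, w⟫ ≤ s := EReal.coe_le_coe_iff.1 ((hminor w).trans hs)
    nlinarith [mul_nonneg hε.le (sq_nonneg ‖w - x₀‖)]
  have hI : ∀ (w : H) (s : ℝ), f w ≤ s → sInf S ≤ s - ⟪m, w⟫ + ε * ‖w - x₀‖ ^ 2 :=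
    fun w s hs => csInf_le hbdd ⟨w, s, hs, rfl⟩
  have hex : ∀ n : ℕ, ∃ (w : H) (s : ℝ), f w ≤ s ∧
      s - ⟪m, w⟫ + ε * ‖w - x₀‖ ^ 2 < sInf S + ε / 4 * (1 / ((n : ℝ) + 1)) := by
    intro n
    obtain ⟨t, ⟨w, s, hs, rfl⟩, hlt⟩ := exists_lt_of_csInf_lt hne
      (lt_add_of_pos_right (sInf S) (by positivity : 0 < ε / 4 * (1 / ((n : ℝ) + 1))))
    exact ⟨w, s, hs, hlt⟩
  choose z r hzr hlt using hex
  have hdist : ∀ i j : ℕ,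
      ‖z i - z j‖ ^ 2 ≤ (1 / ((i : ℝ) + 1) + 1 / ((j : ℝ) + 1)) / 2 := by
    intro i j
    have h1 := hI _ _ (hconv.le_of_le (hzr i) (hzr j) (a := 1 / 2) (b := 1 / 2)
      (by norm_num) (by norm_num) (by norm_num))
    have h2 := parallelogram_law_with_norm ℝ (z i - x₀) (z j - x₀)
    have h3 : ‖(1 / 2 : ℝ) • z i + (1 / 2 : ℝ) • z j - x₀‖
        = ‖(z i - x₀) + (z j - x₀)‖ / 2 := by
      rw [show (1 / 2 : ℝ) • z i + (1 / 2 : ℝ) • z j - x₀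
        = (1 / 2 : ℝ) • ((z i - x₀) + (z j - x₀)) by module, norm_smul]
      norm_num
      ring
    rw [h3, inner_add_right, inner_smul_right, inner_smul_right] at h1
    rw [sub_sub_sub_cancel_right] at h2
    have h4 := hlt i
    have h5 := hlt j
    have h6 : ε * ‖z i - z j‖ ^ 2 ≤ ε * ((1 / ((i : ℝ) + 1) + 1 / ((j : ℝ) + 1)) / 2) := by
      have h7 := congrArg (ε * ·) h2
      linarith
    exact le_of_mul_le_mul_left h6 hε
  have hcauchy : CauchySeq z := by
    rw [Metric.cauchySeq_iff']
    intro δ hδ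
    obtain ⟨N, hN⟩ := exists_nat_one_div_lt (pow_pos hδ 2)
    refine ⟨N, fun n hn => ?_⟩
    rw [dist_eq_norm]
    have h1 : 1 / ((n : ℝ) + 1) ≤ 1 / ((N : ℝ) + 1) := Nat.one_div_le_one_div hn
    refine lt_of_pow_lt_pow_left₀ 2 hδ.le ?_
    linarith [hdist n N]
  obtain ⟨a, ha⟩ := cauchySeq_tendsto_of_complete hcauchy
  refine ⟨a, sInf S + ⟪m, a⟫ - ε * ‖a - x₀‖ ^ 2, ?_, fun w s hs => by linarith [hI w s hs]⟩
  refine hlsc.le_of_tendsto_of_le (z := z) (r := fun n => sInf S + ε / 4 * (1 / ((n : ℝ) + 1))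
    + ⟪m, z n⟫ - ε * ‖z n - x₀‖ ^ 2) ha ?_ (fun n => (hzr n).trans ?_)
  · have h1 : Tendsto (fun n : ℕ => sInf S + ε / 4 * (1 / ((n : ℝ) + 1))) atTop
        (nhds (sInf S)) := by
      simpa using (tendsto_one_div_add_atTop_nhds_zero_nat.const_mul (ε / 4)).const_add (sInf S)
    exact (h1.add (tendsto_const_nhds.inner ha)).sub
      (((ha.sub_const x₀).norm.pow 2).const_mul ε)
  · exact EReal.coe_le_coe_iff.2 (by linarith [hlt n])

omit [CompleteSpace H] in
/-- First-order optimality condition for a minimizer of a quadratic perturbation of a convex function. -/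
theorem ConvexE.sub_smul_mem_subdiffE {f : H → EReal} (hconv : ConvexE f)
    (hnobot : ∀ y, f y ≠ ⊥) {x₀ z m : H} {ε ρ : ℝ} (hz : f z ≤ ρ)
    (hmin : ∀ (w : H) (s : ℝ), f w ≤ s →
      ρ - ⟪m, z⟫ + ε * ‖z - x₀‖ ^ 2 ≤ s - ⟪m, w⟫ + ε * ‖w - x₀‖ ^ 2) :
    m - (2 * ε) • (z - x₀) ∈ SubdiffE f z := by
  intro w
  by_cases htop : f w = ⊤
  · rw [htop]; exact le_top
  have hw : f w = ((f w).toReal : EReal) := (EReal.coe_toReal htop (hnobot w)).symm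
  set s := (f w).toReal
  have key : ∀ t : ℝ, 0 < t → t < 1 →
      ρ + ⟪m - (2 * ε) • (z - x₀), w - z⟫ ≤ s + t * (ε * ‖w - z‖ ^ 2) := by
    intro t ht ht1
    have h1 := hmin _ _ (hconv.le_of_le hz hw.le (a := 1 - t) (b := t)
      (by linarith) ht.le (by ring))
    have h2 : ‖(1 - t) • z + t • w - x₀‖ ^ 2
        = ‖z - x₀‖ ^ 2 + 2 * (t * ⟪z - x₀, w - z⟫) + t ^ 2 * ‖w - z‖ ^ 2 := by
      rw [show (1 - t) • z + t • w - x₀ = (z - x₀) + t • (w - z) by module,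
        norm_add_sq_real, inner_smul_right, norm_smul, mul_pow, Real.norm_eq_abs, sq_abs]
    rw [h2, inner_add_right, inner_smul_right, inner_smul_right] at h1
    have h3 : ⟪m - (2 * ε) • (z - x₀), w - z⟫
        = ⟪m, w⟫ - ⟪m, z⟫ - 2 * ε * ⟪z - x₀, w - z⟫ := by
      rw [inner_sub_left, real_inner_smul_left, inner_sub_right m]
    rw [h3]
    refine le_of_mul_le_mul_left ?_ ht
    nlinarith
  have hlim : Tendsto (fun t : ℝ => s + t * (ε * ‖w - z‖ ^ 2)) (nhdsWithin 0 (Ioi 0))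
      (nhds s) := by
    have : Continuous (fun t : ℝ => s + t * (ε * ‖w - z‖ ^ 2)) := by fun_prop
    simpa using (this.tendsto 0).mono_left nhdsWithin_le_nhds
  have hle : ρ + ⟪m - (2 * ε) • (z - x₀), w - z⟫ ≤ s := by
    refine ge_of_tendsto hlim ?_
    filter_upwards [Ioo_mem_nhdsGT (zero_lt_one' ℝ)] with t ht using key t ht.1 ht.2
  rw [hw]
  calc f z + ((⟪m - (2 * ε) • (z - x₀), w - z⟫ : ℝ) : EReal)
      ≤ (ρ : EReal) + ((⟪m - (2 * ε) • (z - x₀), w - z⟫ : ℝ) : EReal) := by gcongr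
    _ ≤ (s : EReal) := by exact_mod_cast hle

/-- The slope of every affine minorant lies in the closure of the range of the subdifferential. -/
theorem mem_closure_range_subdiffE_of_affine_le {f : H → EReal} (hproper : ∃ y, f y ≠ ⊤)
    (hnobot : ∀ y, f y ≠ ⊥) (hlsc : LowerSemicontinuous f) (hconv : ConvexE f) {m : H} {c : ℝ}
    (hminor : ∀ z, ((c + ⟪m, z⟫ : ℝ) : EReal) ≤ f z) :
    m ∈ closure (⋃ y, SubdiffE f y) := by
  obtain ⟨x₀, hx₀⟩ := hproper
  have hr₀ : f x₀ ≤ ((f x₀).toReal : EReal) := (EReal.coe_toReal hx₀ (hnobot x₀)).ge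
  set r₀ := (f x₀).toReal
  rw [Metric.mem_closure_iff]
  intro δ hδ
  set C := r₀ - ⟪m, x₀⟫ - c with hC
  have hC0 : 0 ≤ C := by
    have : c + ⟪m, x₀⟫ ≤ r₀ := EReal.coe_le_coe_iff.1 ((hminor x₀).trans hr₀)
    linarith
  set ε := δ ^ 2 / (4 * (C + 1)) with hεdef
  have hε : 0 < ε := by positivity
  obtain ⟨z, ρ, hz, hmin⟩ := exists_minimizer_add_sq hlsc hconv hr₀ hminor hε
  refine ⟨_, mem_iUnion.2 ⟨z, hconv.sub_smul_mem_subdiffE hnobot hz hmin⟩, ?_⟩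
  rw [dist_eq_norm, sub_sub_cancel, norm_smul, Real.norm_of_nonneg (by positivity)]
  refine lt_of_pow_lt_pow_left₀ 2 hδ.le ?_
  have h1 := hmin x₀ r₀ hr₀
  have h2 : c + ⟪m, z⟫ ≤ ρ := EReal.coe_le_coe_iff.1 ((hminor z).trans hz)
  have h3 : ε * ‖z - x₀‖ ^ 2 ≤ C := by
    rw [sub_self, norm_zero] at h1
    linarith
  have h4 : 4 * ε * (C + 1) = δ ^ 2 := by rw [hεdef]; field_simp
  calc (2 * ε * ‖z - x₀‖) ^ 2 = 4 * ε * (ε * ‖z - x₀‖ ^ 2) := by ring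
    _ ≤ 4 * ε * C := by gcongr
    _ < δ ^ 2 := by linarith

omit [CompleteSpace H] in
theorem ne_top_of_mem_subdiffE {f : H → EReal} (hproper : ∃ y, f y ≠ ⊤) {x p : H}
    (hp : p ∈ SubdiffE f x) : f x ≠ ⊤ := by
  obtain ⟨y, hy⟩ := hproper
  intro h
  have := hp y
  rw [h, EReal.top_add_coe] at this
  exact hy (top_le_iff.1 this)

omit [CompleteSpace H] in
theorem mem_subdiffE_iff {f : H → EReal} {x p : H} {r : ℝ} (hr : f x = r) :
    p ∈ SubdiffE f x ↔ ∀ y, ((r - ⟪p, x⟫ + ⟪p, y⟫ : ℝ) : EReal) ≤ f y := by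
  refine forall_congr' fun y => ?_
  rw [hr, ← EReal.coe_add, inner_sub_right,
    show r + (⟪p, y⟫ - ⟪p, x⟫) = r - ⟪p, x⟫ + ⟪p, y⟫ by ring]

omit [CompleteSpace H] in
/-- A convex combination of two affine minorants is an affine minorant. -/
theorem affine_combination_le {f : H → EReal} {p q : H} {c d : ℝ}
    (hp : ∀ z, ((c + ⟪p, z⟫ : ℝ) : EReal) ≤ f z) (hq : ∀ z, ((d + ⟪q, z⟫ : ℝ) : EReal) ≤ f z)
    {a b : ℝ} (ha : 0 ≤ a) (hb : 0 ≤ b) (hab : a + b = 1) (z : H) :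
    (((a * c + b * d) + ⟪a • p + b • q, z⟫ : ℝ) : EReal) ≤ f z := by
  have h : (a * c + b * d) + ⟪a • p + b • q, z⟫ ≤ max (c + ⟪p, z⟫) (d + ⟪q, z⟫) := by
    rw [inner_add_left, real_inner_smul_left, real_inner_smul_left]
    have := Convex.combo_le_max (c + ⟪p, z⟫) (d + ⟪q, z⟫) ha hb hab
    simp only [smul_eq_mul] at this
    linarith
  refine (EReal.coe_le_coe_iff.2 h).trans ?_
  rcases max_choice (c + ⟪p, z⟫) (d + ⟪q, z⟫) with h | h <;> rw [h]
  exacts [hp z, hq z]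

theorem convex_closure_range_subdiffE {f : H → EReal} (hproper : ∃ y, f y ≠ ⊤)
    (hnobot : ∀ y, f y ≠ ⊥) (hlsc : LowerSemicontinuous f) (hconv : ConvexE f) :
    Convex ℝ (closure (⋃ y, SubdiffE f y)) := by
  intro p hp q hq a b ha hb hab
  rw [← closure_closure]
  refine map_mem_closure₂ (f := fun u v : H => a • u + b • v) (by fun_prop) hp hq ?_
  intro u hu v hv
  obtain ⟨x, hx⟩ := mem_iUnion.1 hu
  obtain ⟨y, hy⟩ := mem_iUnion.1 hv
  have hfx := (EReal.coe_toReal (ne_top_of_mem_subdiffE hproper hx) (hnobot x)).symm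
  have hfy := (EReal.coe_toReal (ne_top_of_mem_subdiffE hproper hy) (hnobot y)).symm
  exact mem_closure_range_subdiffE_of_affine_le hproper hnobot hlsc hconv
    (affine_combination_le ((mem_subdiffE_iff hfx).1 hx) ((mem_subdiffE_iff hfy).1 hy) ha hb hab)

omit [CompleteSpace H] in
theorem convex_subdiffE {f : H → EReal} {x : H} {r : ℝ} (hr : f x = r) :
    Convex ℝ (SubdiffE f x) := by
  intro p hp q hq a b ha hb hab
  rw [mem_subdiffE_iff hr] at hp hq ⊢
  intro y
  convert affine_combination_le hp hq ha hb hab y using 3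
  rw [inner_add_left, real_inner_smul_left, real_inner_smul_left]
  linear_combination -r * hab

omit [CompleteSpace H] in
theorem isClosed_subdiffE {f : H → EReal} {x : H} {r : ℝ} (hr : f x = r) :
    IsClosed (SubdiffE f x) := by
  have : SubdiffE f x = ⋂ y, {p | ((r - ⟪p, x⟫ + ⟪p, y⟫ : ℝ) : EReal) ≤ f y} := by
    ext p
    rw [mem_subdiffE_iff hr, mem_iInter]
    rfl
  rw [this]
  refine isClosed_iInter fun y => isClosed_le ?_ continuous_const
  exact continuous_coe_real_ereal.comp (by fun_prop)

theorem exists_minNorm_of_isClosed_convex {S : Set H} (hne : S.Nonempty) (hcl : IsClosed S)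
    (hS : Convex ℝ S) : ∃ p ∈ S, ∀ q ∈ S, ‖p‖ ≤ ‖q‖ := by
  obtain ⟨p, hp, h⟩ := exists_norm_eq_iInf_of_complete_convex hne hcl.isComplete hS 0
  refine ⟨p, hp, fun q hq => ?_⟩
  have := ciInf_le (f := fun w : S => ‖(0 : H) - w‖)
    ⟨0, by rintro _ ⟨w, rfl⟩; exact norm_nonneg _⟩ ⟨q, hq⟩
  rw [← h] at this
  simpa using this

omit [InnerProductSpace ℝ H] [CompleteSpace H] in
theorem minNormElt_spec {S : Set H} (h : ∃ p ∈ S, ∀ q ∈ S, ‖p‖ ≤ ‖q‖) :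
    minNormElt S ∈ S ∧ ∀ q ∈ S, ‖minNormElt S‖ ≤ ‖q‖ := by
  rw [minNormElt, dif_pos h]
  exact h.choose_spec

omit [CompleteSpace H] in
theorem Convex.eq_of_minNorm {S : Set H} (hS : Convex ℝ S) {p q : H} (hp : p ∈ S) (hq : q ∈ S)
    (hpmin : ∀ u ∈ S, ‖p‖ ≤ ‖u‖) (hqmin : ∀ u ∈ S, ‖q‖ ≤ ‖u‖) : p = q := by
  have hpq : ‖p‖ = ‖q‖ := le_antisymm (hpmin q hq) (hqmin p hp)
  have h1 := hpmin _ (hS hp hq (a := 1 / 2) (b := 1 / 2) (by norm_num) (by norm_num) (by norm_num))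
  rw [← smul_add, norm_smul, Real.norm_of_nonneg (by norm_num)] at h1
  have h2 := parallelogram_law_with_norm ℝ p q
  rw [← sub_eq_zero, ← norm_eq_zero]
  rw [← hpq] at h2
  nlinarith [norm_nonneg p, norm_nonneg (p - q), norm_nonneg (p + q)]

omit [CompleteSpace H] in
theorem norm_le_of_slopeE_eq_iInf {f : H → EReal} {x p : H}
    (hp : ∀ q ∈ SubdiffE f x, ‖p‖ ≤ ‖q‖) (hx : slopeE f x = ⨅ y, slopeE f y) {q : H}
    (hq : q ∈ closure (⋃ y, SubdiffE f y)) : ‖p‖ ≤ ‖q‖ := by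
  have hsub : (⋃ y, SubdiffE f y) ⊆ {q | ‖p‖ ≤ ‖q‖} := by
    intro q hq
    obtain ⟨y, hy⟩ := mem_iUnion.1 hq
    have h1 : (‖p‖₊ : ℝ≥0∞) ≤ slopeE f x :=
      le_iInf₂ fun u hu => by exact_mod_cast hp u hu
    have h2 : slopeE f y ≤ ‖q‖₊ := iInf₂_le q hy
    have h3 := (h1.trans_eq hx).trans ((iInf_le _ y).trans h2)
    exact_mod_cast h3
  exact closure_minimal hsub (isClosed_le continuous_const continuous_norm) hq

/-- **`f` is affine on the argmin of its slope.**
Let `f` be proper lsc convex with Crandall–Pazy direction `pf` (element of minimal norm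
of the closure of the range of the subdifferential). If `x ∈ dom ∂f` has minimal slope,
i.e. `s_f x = inf_H s_f`, then `∂°f(x) = pf`; consequently, for two such points `x, y`
one has `f y = f x + ⟪pf, y - x⟫`, i.e. `f` is affine on `argmin s_f`. -/
theorem minNorm_eq_CP_on_argmin_slope_and_affine
    (f : H → EReal)
    (hproper : ∃ y, f y ≠ ⊤) (hnobot : ∀ y, f y ≠ ⊥)
    (hlsc : LowerSemicontinuous f) (hconv : ConvexE f)
    (pf : H)
    (hpf : pf ∈ closure (⋃ y, SubdiffE f y) ∧
      ∀ q ∈ closure (⋃ y, SubdiffE f y), ‖pf‖ ≤ ‖q‖) :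
    (∀ x : H, (SubdiffE f x).Nonempty → slopeE f x = (⨅ y, slopeE f y) →
      minNormElt (SubdiffE f x) = pf) ∧
    (∀ x y : H, (SubdiffE f x).Nonempty → slopeE f x = (⨅ z, slopeE f z) →
      (SubdiffE f y).Nonempty → slopeE f y = (⨅ z, slopeE f z) →
      f y = f x + ((⟪pf, y - x⟫ : ℝ) : EReal)) := by
  have hmain : ∀ x : H, (SubdiffE f x).Nonempty → slopeE f x = (⨅ y, slopeE f y) →
      minNormElt (SubdiffE f x) = pf ∧ pf ∈ SubdiffE f x := by
    intro x hne hx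
    have hfx := (EReal.coe_toReal (ne_top_of_mem_subdiffE hproper hne.some_mem) (hnobot x)).symm
    obtain ⟨hmem, hmin⟩ := minNormElt_spec
      (exists_minNorm_of_isClosed_convex hne (isClosed_subdiffE hfx) (convex_subdiffE hfx))
    have heq : minNormElt (SubdiffE f x) = pf :=
      (convex_closure_range_subdiffE hproper hnobot hlsc hconv).eq_of_minNorm
        (subset_closure (mem_iUnion.2 ⟨x, hmem⟩)) hpf.1
        (fun u hu => norm_le_of_slopeE_eq_iInf hmin hx hu) hpf.2
    exact ⟨heq, heq ▸ hmem⟩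
  refine ⟨fun x hne hx => (hmain x hne hx).1, fun x y hxne hx hyne hy => ?_⟩
  have hxp := (hmain x hxne hx).2
  have hyp := (hmain y hyne hy).2
  have hfx := (EReal.coe_toReal (ne_top_of_mem_subdiffE hproper hxp) (hnobot x)).symm
  have hfy := (EReal.coe_toReal (ne_top_of_mem_subdiffE hproper hyp) (hnobot y)).symm
  have h1 := hxp y
  have h2 := hyp x
  rw [hfx, hfy] at h1 h2 ⊢
  norm_cast at h1 h2 ⊢
  rw [inner_sub_right] at h1 h2 ⊢
  linarith
end

section
/- There exists a convex function f : ℝ² → ℝ of class C^∞ such that: (i) its Crandall–Pazy direction is p_f = 0; (ii) inf f = −∞; and (iii) every gradient curve γ of f (i.e., γ′(t) = −∇f(γ(t)) for all t > 0) satisfies ‖γ(t)‖ → +∞, while the set of cluster points as t → +∞ of the normalized displacements (γ(t) − γ(0))/‖γ(t) − γ(0)‖ contains at least two distinct unit vectors (in particular, the set of secant directions at infinity Sec(γ, +∞) is not a singleton). -/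
open Set Filter
open scoped Topology

/-- Minus the derivative of the one-dimensional convex potential with oscillation parameter `a`. -/
noncomputable def oscSpeed (a x : ℝ) : ℝ :=
  Real.exp (-Real.arsinh x) / (2 + a * Real.sin (Real.arsinh x))

/-- The one-dimensional convex potential whose descent speed is `oscSpeed a`. -/
noncomputable def oscPotential (a x : ℝ) : ℝ := -∫ s in (0 : ℝ)..x, oscSpeed a s

/-- The time elapsed along the descent flow of `oscPotential a`, in the coordinate `arsinh x`. -/
noncomputable def oscTime (a u : ℝ) : ℝ :=
  (Real.exp (2 * u) * (1 + a * (2 * Real.sin u - Real.cos u) / 5) + 2 * u - a * Real.cos u) / 2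

section OneDim

variable {a : ℝ}

lemma one_le_two_add_mul_sin (ha : |a| ≤ 1) (u : ℝ) : 1 ≤ 2 + a * Real.sin u := by
  have h : |a * Real.sin u| ≤ 1 := by
    rw [abs_mul]
    exact mul_le_one₀ ha (abs_nonneg _) (Real.abs_sin_le_one u)
  linarith [(abs_le.1 h).1]

lemma contDiff_oscSpeed (ha : |a| ≤ 1) : ContDiff ℝ (⊤ : ℕ∞) (oscSpeed a) := by
  have h : ContDiff ℝ (⊤ : ℕ∞) Real.arsinh := Real.contDiff_arsinh
  refine (Real.contDiff_exp.comp h.neg).div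
    (contDiff_const.add (contDiff_const.mul (Real.contDiff_sin.comp h))) fun x ↦
      (zero_lt_one.trans_le (one_le_two_add_mul_sin ha (Real.arsinh x))).ne'

lemma oscSpeed_pos (ha : |a| ≤ 1) (x : ℝ) : 0 < oscSpeed a x :=
  div_pos (Real.exp_pos _) (by linarith [one_le_two_add_mul_sin ha (Real.arsinh x)])

lemma oscSpeed_le (ha : |a| ≤ 1) (x : ℝ) : oscSpeed a x ≤ Real.exp (-Real.arsinh x) :=
  div_le_self (Real.exp_pos _).le (one_le_two_add_mul_sin ha _)

lemma oscSpeed_antitone (ha : |a| ≤ 1) : Antitone (oscSpeed a) := by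
  have hanti : Antitone fun u : ℝ ↦ Real.exp (-u) / (2 + a * Real.sin u) := by
    have hpos : ∀ u : ℝ, 0 < 2 + a * Real.sin u := fun u ↦ by
      linarith [one_le_two_add_mul_sin ha u]
    have hd : ∀ u : ℝ, HasDerivAt (fun u : ℝ ↦ Real.exp (-u) / (2 + a * Real.sin u))
        ((Real.exp (-u) * (-1) * (2 + a * Real.sin u) - Real.exp (-u) * (a * Real.cos u)) /
          (2 + a * Real.sin u) ^ 2) u := fun u ↦
      ((hasDerivAt_neg u).exp).div (((Real.hasDerivAt_sin u).const_mul a).const_add 2)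
        (hpos u).ne'
    refine antitone_of_deriv_nonpos (fun u ↦ (hd u).differentiableAt) fun u ↦ ?_
    rw [(hd u).deriv]
    refine div_nonpos_of_nonpos_of_nonneg ?_ (sq_nonneg _)
    have h : |a * (Real.sin u + Real.cos u)| ≤ 2 := by
      rw [abs_mul]
      have h1 : |Real.sin u + Real.cos u| ≤ 2 := by
        have := abs_add_le (Real.sin u) (Real.cos u)
        linarith [Real.abs_sin_le_one u, Real.abs_cos_le_one u]
      nlinarith [abs_nonneg a, abs_nonneg (Real.sin u + Real.cos u)]
    have := (abs_le.1 h).1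
    nlinarith [Real.exp_pos (-u)]
  exact hanti.comp_monotone Real.arsinh_strictMono.monotone

lemma hasDerivAt_oscPotential (ha : |a| ≤ 1) (x : ℝ) :
    HasDerivAt (oscPotential a) (-oscSpeed a x) x :=
  ((contDiff_oscSpeed ha).continuous.integral_hasStrictDerivAt 0 x).hasDerivAt.neg

lemma deriv_oscPotential (ha : |a| ≤ 1) : deriv (oscPotential a) = fun x ↦ -oscSpeed a x :=
  funext fun x ↦ (hasDerivAt_oscPotential ha x).deriv

lemma contDiff_oscPotential (ha : |a| ≤ 1) : ContDiff ℝ (⊤ : ℕ∞) (oscPotential a) := by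
  rw [contDiff_infty_iff_deriv, deriv_oscPotential ha]
  exact ⟨fun x ↦ (hasDerivAt_oscPotential ha x).differentiableAt, (contDiff_oscSpeed ha).neg⟩

lemma convexOn_oscPotential (ha : |a| ≤ 1) : ConvexOn ℝ univ (oscPotential a) := by
  refine Monotone.convexOn_univ_of_deriv
    (fun x ↦ (hasDerivAt_oscPotential ha x).differentiableAt) ?_
  rw [deriv_oscPotential ha]
  exact fun x y hxy ↦ neg_le_neg (oscSpeed_antitone ha hxy)

lemma hasDerivAt_oscTime (u : ℝ) :
    HasDerivAt (oscTime a) (Real.exp u * Real.cosh u * (2 + a * Real.sin u)) u := by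
  have h1 : HasDerivAt (fun u : ℝ ↦ Real.exp (2 * u)) (Real.exp (2 * u) * (2 * 1)) u :=
    ((hasDerivAt_id u).const_mul 2).exp
  have h2 : HasDerivAt (fun u : ℝ ↦ 1 + a * (2 * Real.sin u - Real.cos u) / 5)
      (a * (2 * Real.cos u - -Real.sin u) / 5) u :=
    (((((Real.hasDerivAt_sin u).const_mul 2).sub (Real.hasDerivAt_cos u)).const_mul a).div_const
      5).const_add 1
  have h3 := (((h1.mul h2).add ((hasDerivAt_id u).const_mul 2)).sub
    ((Real.hasDerivAt_cos u).const_mul a)).div_const 2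
  refine h3.congr_deriv ?_
  have h4 : Real.exp (2 * u) = Real.exp u * Real.exp u := by rw [← Real.exp_add, two_mul]
  have h5 : Real.exp u * Real.exp (-u) = 1 := by rw [← Real.exp_add]; simp
  rw [Real.cosh_eq, h4]
  linear_combination -(2 + a * Real.sin u) / 2 * h5

lemma oscTime_strictMono (ha : |a| ≤ 1) : StrictMono (oscTime a) := by
  refine strictMono_of_deriv_pos fun u ↦ ?_
  rw [(hasDerivAt_oscTime u).deriv]
  have := one_le_two_add_mul_sin ha u
  have := Real.cosh_pos u
  positivity

lemma exists_oscTime_eq_add (ha : |a| ≤ 1) {x : ℝ → ℝ}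
    (hx : ∀ t > 0, HasDerivAt x (oscSpeed a (x t)) t) :
    ∃ c, ∀ t > 0, oscTime a (Real.arsinh (x t)) = t + c := by
  have hd : ∀ t > 0, HasDerivAt (fun t ↦ oscTime a (Real.arsinh (x t)) - t) 0 t := by
    intro t ht
    have h := ((hasDerivAt_oscTime (a := a) (Real.arsinh (x t))).comp t (hx t ht).arsinh).sub
      (hasDerivAt_id t)
    refine h.congr_deriv ?_
    have h1 := one_le_two_add_mul_sin ha (Real.arsinh (x t))
    have h2 : 0 < √(1 + x t ^ 2) := by positivity
    rw [oscSpeed, Real.cosh_arsinh, Real.exp_neg]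
    have h3 : 2 + a * Real.sin (Real.arsinh (x t)) ≠ 0 := by linarith
    simp only [smul_eq_mul]
    field_simp
    ring
  obtain ⟨c, hc⟩ := isOpen_Ioi.exists_is_const_of_deriv_eq_zero (s := Ioi (0 : ℝ))
    isPreconnected_Ioi (fun t ht ↦ (hd t ht).differentiableAt.differentiableWithinAt)
    (fun t ht ↦ (hd t ht).deriv)
  exact ⟨c, fun t ht ↦ by linarith [hc t ht]⟩

lemma tendsto_arsinh_of_oscTime (ha : |a| ≤ 1) {x : ℝ → ℝ} {c : ℝ}
    (hx : ∀ t > 0, oscTime a (Real.arsinh (x t)) = t + c) :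
    Tendsto (fun t ↦ Real.arsinh (x t)) atTop atTop := by
  refine tendsto_atTop.2 fun M ↦ ?_
  filter_upwards [eventually_gt_atTop 0, eventually_gt_atTop (oscTime a M - c)] with t h0 h1
  exact ((oscTime_strictMono ha).lt_iff_lt.1 (by rw [hx t h0]; linarith)).le

lemma tendsto_oscTime (ha : |a| ≤ 1) : Tendsto (oscTime a) atTop atTop := by
  refine tendsto_atTop_mono' atTop ?_ (tendsto_atTop_add_const_right atTop (-1) tendsto_id)
  filter_upwards with u
  have h1 : |a * Real.cos u| ≤ 1 := by
    rw [abs_mul]; exact mul_le_one₀ ha (abs_nonneg _) (Real.abs_cos_le_one u)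
  have h2 : |a * Real.sin u| ≤ 1 := by
    rw [abs_mul]; exact mul_le_one₀ ha (abs_nonneg _) (Real.abs_sin_le_one u)
  have h3 : 0 ≤ Real.exp (2 * u) * (1 + a * (2 * Real.sin u - Real.cos u) / 5) := by
    refine mul_nonneg (Real.exp_pos _).le ?_
    linarith [(abs_le.1 h1).2, (abs_le.1 h2).1]
  simp only [id, oscTime]
  linarith [(abs_le.1 h1).2]

lemma tendsto_oscPotential_zero : Tendsto (oscPotential 0) atTop atBot := by
  have hd : ∀ x : ℝ, HasDerivAt (fun x ↦ (Real.arsinh x - Real.exp (-2 * Real.arsinh x) / 2) / 4)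
      (oscSpeed 0 x) x := by
    intro x
    have h := (((Real.hasDerivAt_arsinh x).sub
      (((Real.hasDerivAt_arsinh x).const_mul (-2)).exp.div_const 2)).div_const 4)
    refine h.congr_deriv ?_
    have h1 : Real.exp (-2 * Real.arsinh x) = Real.exp (-Real.arsinh x) ^ 2 := by
      rw [← Real.exp_nat_mul]; congr 1; push_cast; ring
    have h2 : Real.exp (Real.arsinh x) * Real.exp (-Real.arsinh x) = 1 := by
      rw [← Real.exp_add]; simp
    rw [oscSpeed, h1, ← Real.cosh_arsinh]
    have h3 : Real.cosh (Real.arsinh x) ≠ 0 := (Real.cosh_pos _).ne'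
    field_simp
    rw [Real.cosh_eq]
    linear_combination -2 * h2
  have hp : ∀ᶠ x in atTop, oscPotential 0 x ≤ Real.arsinh x * (-(1 / 4)) := by
    filter_upwards [eventually_ge_atTop 0] with x hx
    have : IntervalIntegrable (oscSpeed 0) MeasureTheory.volume 0 x :=
      (contDiff_oscSpeed (by simp)).continuous.intervalIntegrable _ _
    rw [oscPotential, intervalIntegral.integral_eq_sub_of_hasDerivAt (fun y _ ↦ hd y) this]
    have h1 : Real.exp (-2 * Real.arsinh x) ≤ 1 :=
      Real.exp_le_one_iff.2 (by linarith [Real.arsinh_nonneg_iff.2 hx])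
    simp only [Real.arsinh_zero, mul_zero, Real.exp_zero]
    linarith
  refine tendsto_atBot_mono' atTop hp ?_
  exact Tendsto.atTop_mul_const_of_neg (by norm_num)
    (Real.arsinh_strictMono.monotone.tendsto_atTop_atTop fun b ↦
      ⟨Real.sinh b, by rw [Real.arsinh_sinh]⟩)

end OneDim

lemma tendsto_mul_exp_neg_two_mul :
    Tendsto (fun u : ℝ ↦ 2 * u * Real.exp (-2 * u)) atTop (𝓝 0) := by
  have h := (Real.tendsto_pow_mul_exp_neg_atTop_nhds_zero 1).comp
    (tendsto_id.const_mul_atTop (zero_lt_two' ℝ))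
  refine h.congr fun u ↦ ?_
  simp

lemma tendsto_two_mul_exp_neg_mul_sinh {ι : Type*} {l : Filter ι} {u v : ι → ℝ} {r : ℝ}
    (hu : Tendsto u l atTop) (hv : Tendsto v l atTop)
    (h : Tendsto (fun i ↦ Real.exp (v i - u i)) l (𝓝 r)) :
    Tendsto (fun i ↦ 2 * Real.exp (-u i) * Real.sinh (v i)) l (𝓝 r) := by
  have h1 : Tendsto (fun i ↦ Real.exp (-(u i + v i))) l (𝓝 0) :=
    Real.tendsto_exp_neg_atTop_nhds_zero.comp (hu.atTop_add_atTop hv)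
  have h2 := h.sub h1
  rw [sub_zero] at h2
  refine h2.congr fun i ↦ ?_
  rw [Real.sinh_eq, sub_eq_add_neg (v i), Real.exp_add, neg_add, Real.exp_add]
  ring

lemma tendsto_exp_sub_of_oscTime {ι : Type*} {l : Filter ι} {u v : ι → ℝ} {c k : ℝ}
    (hu : Tendsto u l atTop) (hv : Tendsto v l atTop)
    (hsin : ∀ i, Real.sin (u i) = 0) (hcos : ∀ i, Real.cos (u i) = k)
    (h : ∀ᶠ i in l, oscTime 0 (v i) = oscTime 1 (u i) + c) :
    Tendsto (fun i ↦ Real.exp (v i - u i)) l (𝓝 √(1 - k / 5)) := by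
  have h0 : Tendsto (fun i ↦ Real.exp (-2 * u i)) l (𝓝 0) := by
    refine Real.tendsto_exp_atBot.comp ?_
    exact hu.const_mul_atTop_of_neg (by norm_num)
  have hnum : Tendsto (fun i ↦ (1 - k / 5) + 2 * u i * Real.exp (-2 * u i) +
      (2 * c - k) * Real.exp (-2 * u i)) l (𝓝 ((1 - k / 5) + 0 + (2 * c - k) * 0)) :=
    (tendsto_const_nhds.add (tendsto_mul_exp_neg_two_mul.comp hu)).add (h0.const_mul _)
  have hden : Tendsto (fun i ↦ 1 + 2 * v i * Real.exp (-2 * v i)) l (𝓝 (1 + 0)) :=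
    tendsto_const_nhds.add (tendsto_mul_exp_neg_two_mul.comp hv)
  have hq := (hnum.div hden (by norm_num)).sqrt
  rw [add_zero, mul_zero, add_zero, add_zero, div_one] at hq
  refine hq.congr' ?_
  filter_upwards [h, hv.eventually_gt_atTop 0] with i hi hvi
  have hpos : 0 < 1 + 2 * v i * Real.exp (-2 * v i) := by positivity
  rw [Real.sqrt_eq_iff_mul_self_eq_of_pos (Real.exp_pos _), Pi.div_apply, eq_div_iff hpos.ne']
  have e1 : Real.exp (v i - u i) * Real.exp (v i - u i) =
      Real.exp (2 * v i) * Real.exp (-2 * u i) := by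
    rw [← Real.exp_add, ← Real.exp_add]; congr 1; ring
  have e2 : Real.exp (2 * v i) * Real.exp (-2 * v i) = 1 := by
    rw [← Real.exp_add]; simp
  have e3 : Real.exp (2 * u i) * Real.exp (-2 * u i) = 1 := by
    rw [← Real.exp_add]; simp
  simp only [oscTime, hsin i, hcos i] at hi
  rw [e1]
  linear_combination 2 * Real.exp (-2 * u i) * hi + 2 * v i * Real.exp (-2 * u i) * e2 +
    (1 - k / 5) * e3

lemma tendsto_inv_norm_smul {ι E : Type*} [NormedAddCommGroup E] [NormedSpace ℝ E] {l : Filter ι}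
    {D : ι → E} {r : ι → ℝ} {w : E} (hr : ∀ i, 0 < r i) (hw : w ≠ 0)
    (h : Tendsto (fun i ↦ r i • D i) l (𝓝 w)) :
    Tendsto (fun i ↦ ‖D i‖⁻¹ • D i) l (𝓝 (‖w‖⁻¹ • w)) := by
  refine ((h.norm.inv₀ (norm_ne_zero_iff.2 hw)).smul h).congr fun i ↦ ?_
  rw [norm_smul, Real.norm_of_nonneg (hr i).le, mul_inv, smul_smul, mul_right_comm,
    inv_mul_cancel₀ (hr i).ne', one_mul]

lemma one_left_ne_zero (b : ℝ) : (!₂[1, b] : EuclideanSpace ℝ (Fin 2)) ≠ 0 := fun h ↦ by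
  simpa using congrArg (fun w : EuclideanSpace ℝ (Fin 2) ↦ w 0) h

lemma mapClusterPt_of_oscTime {γ : ℝ → EuclideanSpace ℝ (Fin 2)} {c d θ k : ℝ}
    (hc : ∀ t > 0, oscTime 1 (Real.arsinh (γ t 0)) = t + c)
    (hd : ∀ t > 0, oscTime 0 (Real.arsinh (γ t 1)) = t + d)
    (hsin : Real.sin θ = 0) (hcos : Real.cos θ = k) :
    MapClusterPt (‖!₂[1, √(1 - k / 5)]‖⁻¹ • !₂[1, √(1 - k / 5)]) atTop
      (fun t ↦ ‖γ t - γ 0‖⁻¹ • (γ t - γ 0)) := by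
  set s : ℕ → ℝ := fun n ↦ θ + n * (2 * Real.pi) with hs
  have hs_top : Tendsto s atTop atTop :=
    tendsto_atTop_add_const_left _ _
      (tendsto_natCast_atTop_atTop.atTop_mul_const Real.two_pi_pos)
  set τ : ℕ → ℝ := fun n ↦ oscTime 1 (s n) - c with hτ
  have hτ_top : Tendsto τ atTop atTop :=
    tendsto_atTop_add_const_right _ _ ((tendsto_oscTime (by simp)).comp hs_top)
  have hx : ∀ᶠ n in atTop, γ (τ n) 0 = Real.sinh (s n) := by
    filter_upwards [hτ_top.eventually_gt_atTop 0] with n hn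
    have h := hc _ hn
    rw [hτ, sub_add_cancel] at h
    rw [← (oscTime_strictMono (by simp)).injective h, Real.sinh_arsinh]
  have hv := (tendsto_arsinh_of_oscTime (by simp) hd).comp hτ_top
  have hexp := tendsto_exp_sub_of_oscTime (c := d - c) hs_top hv
    (fun n ↦ by rw [hs, Real.sin_add_nat_mul_two_pi, hsin])
    (fun n ↦ by rw [hs, Real.cos_add_nat_mul_two_pi, hcos])
    (by
      filter_upwards [hτ_top.eventually_gt_atTop 0] with n hn
      rw [Function.comp_apply, hd _ hn]
      simp only [hτ]; ring)
  have h1 : Tendsto (fun n ↦ 2 * Real.exp (-s n) * γ (τ n) 1) atTop (𝓝 √(1 - k / 5)) := by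
    refine (tendsto_two_mul_exp_neg_mul_sinh hs_top hv hexp).congr fun n ↦ ?_
    rw [Function.comp_apply, Real.sinh_arsinh]
  have h0 : Tendsto (fun n ↦ 2 * Real.exp (-s n) * γ (τ n) 0) atTop (𝓝 1) := by
    refine (tendsto_two_mul_exp_neg_mul_sinh hs_top hs_top (by simp)).congr' ?_
    filter_upwards [hx] with n hn
    rw [hn]
  have hz : Tendsto (fun n ↦ 2 * Real.exp (-s n)) atTop (𝓝 0) := by
    simpa using (Real.tendsto_exp_neg_atTop_nhds_zero.comp hs_top).const_mul 2
  have hlim : Tendsto (fun n ↦ (2 * Real.exp (-s n)) • (γ (τ n) - γ 0)) atTop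
      (𝓝 !₂[1, √(1 - k / 5)]) := by
    have hpi : Tendsto (fun n ↦ fun i ↦ ((2 * Real.exp (-s n)) • (γ (τ n) - γ 0)) i) atTop
        (𝓝 ![1, √(1 - k / 5)]) := by
      refine tendsto_pi_nhds.2 fun i ↦ ?_
      fin_cases i
      · simpa [mul_sub] using h0.sub (hz.mul_const (γ 0 0))
      · simpa [mul_sub] using h1.sub (hz.mul_const (γ 0 1))
    exact ((PiLp.continuous_toLp 2 _).tendsto _).comp hpi
  exact MapClusterPt.of_comp hτ_top
    (tendsto_inv_norm_smul (fun n ↦ by positivity) (one_left_ne_zero _) hlim).mapClusterPt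

/-- The `i`-th coordinate on the plane. -/
noncomputable abbrev planeCoord (i : Fin 2) : EuclideanSpace ℝ (Fin 2) →L[ℝ] ℝ :=
  EuclideanSpace.proj i

/-- The separable potential on the plane, oscillating in the first coordinate only. -/
noncomputable def planePotential (p : EuclideanSpace ℝ (Fin 2)) : ℝ :=
  oscPotential 1 (p 0) + oscPotential 0 (p 1)

lemma hasGradientAt_planePotential (p : EuclideanSpace ℝ (Fin 2)) :
    HasGradientAt planePotential !₂[-oscSpeed 1 (p 0), -oscSpeed 0 (p 1)] p := by
  rw [hasGradientAt_iff_hasFDerivAt]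
  have h0 := (hasDerivAt_oscPotential (a := 1) (by simp) (p 0)).comp_hasFDerivAt p
    (planeCoord 0).hasFDerivAt
  have h1 := (hasDerivAt_oscPotential (a := 0) (by simp) (p 1)).comp_hasFDerivAt p
    (planeCoord 1).hasFDerivAt
  refine (h0.add h1).congr_fderiv ?_
  ext v
  simp [InnerProductSpace.toDual_apply_apply, PiLp.inner_apply, Fin.sum_univ_two, mul_comm]

lemma contDiff_planePotential : ContDiff ℝ (⊤ : ℕ∞) planePotential :=
  ((contDiff_oscPotential (by simp)).comp
    (planeCoord 0).contDiff).add
  ((contDiff_oscPotential (by simp)).comp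
    (planeCoord 1).contDiff)

lemma convexOn_planePotential : ConvexOn ℝ univ planePotential :=
  ((convexOn_oscPotential (by simp)).comp_linearMap
    (planeCoord 0).toLinearMap).add
  ((convexOn_oscPotential (by simp)).comp_linearMap
    (planeCoord 1).toLinearMap)

lemma tendsto_oscSpeed_sinh {a : ℝ} (ha : |a| ≤ 1) :
    Tendsto (fun n : ℕ ↦ oscSpeed a (Real.sinh n)) atTop (𝓝 0) := by
  refine squeeze_zero (fun n ↦ (oscSpeed_pos ha _).le) (fun n ↦ oscSpeed_le ha _) ?_
  simp only [Real.arsinh_sinh]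
  exact Real.tendsto_exp_neg_atTop_nhds_zero.comp tendsto_natCast_atTop_atTop

lemma zero_mem_closure_range_gradient_planePotential :
    (0 : EuclideanSpace ℝ (Fin 2)) ∈ closure (range (gradient planePotential)) := by
  have hpi : Tendsto (fun n : ℕ ↦ ![-oscSpeed 1 (Real.sinh n), -oscSpeed 0 (Real.sinh n)]) atTop
      (𝓝 0) := by
    refine tendsto_pi_nhds.2 fun i ↦ ?_
    fin_cases i
    · simpa using (tendsto_oscSpeed_sinh (a := 1) (by simp)).neg
    · simpa using (tendsto_oscSpeed_sinh (a := 0) (by simp)).neg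
  refine mem_closure_of_tendsto (((PiLp.continuous_toLp 2 _).tendsto _).comp hpi)
    (Eventually.of_forall fun n ↦ ⟨!₂[Real.sinh n, Real.sinh n], ?_⟩)
  rw [(hasGradientAt_planePotential _).gradient]
  simp

lemma inv_norm_smul_ne {b c : ℝ} (h : b ≠ c) :
    ‖!₂[1, b]‖⁻¹ • !₂[1, b] ≠ ‖!₂[1, c]‖⁻¹ • !₂[1, c] := fun heq ↦ by
  have h0 : ‖!₂[1, b]‖⁻¹ = ‖!₂[1, c]‖⁻¹ := by
    simpa [-inv_inj] using congrArg (fun w : EuclideanSpace ℝ (Fin 2) ↦ w 0) heq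
  rw [← h0] at heq
  have h1 := congrArg (fun w : EuclideanSpace ℝ (Fin 2) ↦ w 1)
    (smul_right_injective _ (inv_ne_zero (norm_ne_zero_iff.2 (one_left_ne_zero b))) heq)
  exact h (by simpa using h1)

lemma norm_inv_norm_smul_one_right (b : ℝ) :
    ‖‖!₂[1, b]‖⁻¹ • !₂[1, b]‖ = 1 := by
  rw [norm_smul, norm_inv, norm_norm, inv_mul_cancel₀ (norm_ne_zero_iff.2 (one_left_ne_zero b))]

/-- **A smooth convex function, unbounded below, with `p_f = 0`, whose gradient curves
do not converge cosmically.** There is a `C^∞` convex function `f : ℝ² → ℝ` such that: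
(i) its Crandall–Pazy direction is `0` (i.e. `0` lies in the closure of the range of
`∇f`); (ii) `inf f = -∞`; (iii) every gradient curve `γ` of `f` escapes to infinity in
norm, while its normalized displacements admit at least two distinct unit cluster
directions — so the set of secants at infinity is not a singleton. -/
theorem exists_smooth_convex_unbounded_noncosmic :
    ∃ f : EuclideanSpace ℝ (Fin 2) → ℝ,
      ContDiff ℝ (⊤ : ℕ∞) f ∧ ConvexOn ℝ Set.univ f ∧
      (0 : EuclideanSpace ℝ (Fin 2)) ∈ closure (Set.range (gradient f)) ∧
      (∀ c : ℝ, ∃ x, f x < c) ∧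
      ∀ γ : ℝ → EuclideanSpace ℝ (Fin 2),
        ContinuousOn γ (Set.Ici 0) →
        (∀ t > (0:ℝ), HasDerivAt γ (-gradient f (γ t)) t) →
        Filter.Tendsto (fun t => ‖γ t‖) Filter.atTop Filter.atTop ∧
        ∃ q₁ q₂ : EuclideanSpace ℝ (Fin 2), q₁ ≠ q₂ ∧ ‖q₁‖ = 1 ∧ ‖q₂‖ = 1 ∧
          MapClusterPt q₁ Filter.atTop (fun t => ‖γ t - γ 0‖⁻¹ • (γ t - γ 0)) ∧
          MapClusterPt q₂ Filter.atTop (fun t => ‖γ t - γ 0‖⁻¹ • (γ t - γ 0)) := by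
  refine ⟨planePotential, contDiff_planePotential, convexOn_planePotential,
    zero_mem_closure_range_gradient_planePotential, fun c ↦ ?_, fun γ _ hγ ↦ ?_⟩
  · obtain ⟨y, hy⟩ :=
      (tendsto_oscPotential_zero.eventually_lt_atBot (c - oscPotential 1 0)).exists
    exact ⟨!₂[0, y], by simp only [planePotential]; simp; linarith⟩
  have hcoord : ∀ t > 0, ∀ i, HasDerivAt (fun t ↦ γ t i)
      (!₂[oscSpeed 1 (γ t 0), oscSpeed 0 (γ t 1)] i) t := fun t ht i ↦ by
    have h := (planeCoord i).hasFDerivAt.comp_hasDerivAt t (hγ t ht)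
    rw [(hasGradientAt_planePotential _).gradient] at h
    refine h.congr_deriv ?_
    fin_cases i <;> simp
  obtain ⟨c, hc⟩ := exists_oscTime_eq_add (a := 1) (by simp) fun t ht ↦ by simpa using hcoord t ht 0
  obtain ⟨d, hd⟩ := exists_oscTime_eq_add (a := 0) (by simp) fun t ht ↦ by simpa using hcoord t ht 1
  refine ⟨?_, _, _, inv_norm_smul_ne ?_, norm_inv_norm_smul_one_right _,
    norm_inv_norm_smul_one_right _,
    mapClusterPt_of_oscTime hc hd Real.sin_zero Real.cos_zero,
    mapClusterPt_of_oscTime hc hd Real.sin_pi Real.cos_pi⟩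
  · have hu := tendsto_arsinh_of_oscTime (by simp) hc
    refine tendsto_atTop_mono' atTop ?_ hu
    filter_upwards [hu.eventually_ge_atTop 0] with t ht
    calc Real.arsinh (γ t 0) ≤ Real.sinh (Real.arsinh (γ t 0)) := Real.self_le_sinh_iff.2 ht
      _ = γ t 0 := Real.sinh_arsinh _
      _ ≤ ‖γ t 0‖ := Real.le_norm_self _
      _ ≤ ‖γ t‖ := PiLp.norm_apply_le _ _
  · exact (Real.sqrt_lt_sqrt (by norm_num) (by norm_num)).ne
end

section
/- Let φ : ℝ → ℝ be a C^∞ function that is strictly positive and decreasing, with ∫₀^{+∞} φ(s) ds = +∞, and let r(t) = ∫₀^t φ(s) ds (so r is an increasing C^∞ diffeomorphism of ℝ onto ℝ). Then there exists a C^∞ convex function Φ : ℝ → ℝ (namely Φ(u) = −∫₀^u φ(r⁻¹(v)) dv, satisfying Φ′(r(t)) = −φ(t) for all t ∈ ℝ) such that for every x ∈ ℝ the curve γ_x(t) := r(x + t) satisfies γ_x′(t) = −Φ′(γ_x(t)) = φ(x + t) for all t > 0; that is, γ_x is a gradient curve of Φ with speed φ(x + t). -/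
open Set Filter intervalIntegral

/-- A primitive of a `C^∞` function is `C^∞`. -/
theorem contDiff_intervalIntegral_right {f : ℝ → ℝ} (hf : ContDiff ℝ (⊤ : ℕ∞) f) (a : ℝ) :
    ContDiff ℝ (⊤ : ℕ∞) (fun t => ∫ s in a..t, f s) := by
  refine contDiff_infty_iff_deriv.2 ⟨fun t =>
    (hf.continuous.integral_hasStrictDerivAt a t).hasDerivAt.differentiableAt, ?_⟩
  rwa [funext (hf.continuous.deriv_integral f a)]

/-- The primitive from `0` of a continuous antitone function that is positive at `0` tends to
`-∞` at `-∞`. -/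
theorem tendsto_intervalIntegral_atBot_of_antitone {f : ℝ → ℝ} (hf : Antitone f) (h0 : 0 < f 0) :
    Tendsto (fun t => ∫ s in (0 : ℝ)..t, f s) atBot atBot := by
  refine tendsto_atBot_mono' atBot ?_ (tendsto_id.atBot_mul_const h0)
  filter_upwards [eventually_le_atBot (0 : ℝ)] with t ht
  have h := integral_mono_on (μ := MeasureTheory.volume) ht (intervalIntegrable_const (c := f 0))
    hf.intervalIntegrable fun s hs => hf hs.2
  rw [integral_const, smul_eq_mul] at h
  rw [integral_symm]
  simp only [id]
  linarith

/-- **One-dimensional construction of a convex potential with prescribed gradient-curve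
speed.** Let `φ : ℝ → ℝ` be `C^∞`, strictly positive and decreasing, with
`∫₀^∞ φ = +∞` (i.e. `r T = ∫₀^T φ → ∞` as `T → ∞`). Then there is a `C^∞` convex
function `Φ : ℝ → ℝ` with `Φ'(r t) = -φ t` for all `t`, such that for every `x ∈ ℝ`
the curve `γ_x(t) = r(x + t)` satisfies, for all `t > 0`,
`γ_x'(t) = φ(x + t)` and `Φ'(γ_x t) = -φ(x + t)`; that is, `γ_x` is a gradient curve
of `Φ` (`γ_x' = -Φ' ∘ γ_x`) with speed `φ(x + t)`. -/
theorem exists_convex_potential_with_prescribed_speed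
    (φ : ℝ → ℝ)
    (hsmooth : ContDiff ℝ (⊤ : ℕ∞) φ)
    (hpos : ∀ t, 0 < φ t)
    (hdec : StrictAnti φ)
    (hdiv : Filter.Tendsto (fun T => ∫ s in (0:ℝ)..T, φ s) Filter.atTop Filter.atTop) :
    ∃ Φ : ℝ → ℝ,
      ContDiff ℝ (⊤ : ℕ∞) Φ ∧ ConvexOn ℝ Set.univ Φ ∧
      (∀ t : ℝ, deriv Φ (∫ s in (0:ℝ)..t, φ s) = -φ t) ∧
      (∀ x : ℝ, ∀ t > (0:ℝ),
        HasDerivAt (fun u => ∫ s in (0:ℝ)..(x + u), φ s) (φ (x + t)) t ∧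
        deriv Φ (∫ s in (0:ℝ)..(x + t), φ s) = -φ (x + t)) := by
  set r : ℝ → ℝ := fun t => ∫ s in (0 : ℝ)..t, φ s
  have hr : ∀ t, HasDerivAt r (φ t) t := fun t =>
    (hsmooth.continuous.integral_hasStrictDerivAt 0 t).hasDerivAt
  have hr_smooth : ContDiff ℝ (⊤ : ℕ∞) r := contDiff_intervalIntegral_right hsmooth 0
  have hr_mono : StrictMono r := strictMono_of_deriv_pos fun t => (hr t).deriv ▸ hpos t
  have hr_surj : Function.Surjective r := hr_smooth.continuous.surjective hdiv
    (tendsto_intervalIntegral_atBot_of_antitone hdec.antitone (hpos 0))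
  let e : ℝ ≃o ℝ := hr_mono.orderIsoOfSurjective r hr_surj
  have he_smooth : ContDiff ℝ (⊤ : ℕ∞) e.symm :=
    e.toHomeomorph.contDiff_symm_deriv (fun t => (hpos t).ne') hr hr_smooth
  have hg : ContDiff ℝ (⊤ : ℕ∞) fun v => -φ (e.symm v) := (hsmooth.comp he_smooth).neg
  have hderiv := hg.continuous.deriv_integral _ 0
  have hderiv_r : ∀ t, deriv (fun u => ∫ v in (0 : ℝ)..u, -φ (e.symm v)) (r t) = -φ t := fun t => by
    rw [hderiv, show e.symm (r t) = t from e.symm_apply_apply t]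
  refine ⟨fun u => ∫ v in (0 : ℝ)..u, -φ (e.symm v), contDiff_intervalIntegral_right hg 0,
    Monotone.convexOn_univ_of_deriv
      ((contDiff_intervalIntegral_right hg 0).differentiable (by simp)) ?_,
    hderiv_r, fun x t _ => ⟨(hr (x + t)).comp_const_add x t, hderiv_r (x + t)⟩⟩
  rw [funext hderiv]
  exact fun u v huv => neg_le_neg (hdec.antitone (e.symm.monotone huv))
end

section
/- Let H be a real Hilbert space, let (f_i)_{i ∈ ℕ} be a countable family of convex continuous functions f_i : H → ℝ, and let A ⊂ H be a nonempty separable subset. For each i and x ∈ H, let S_{f_i}(x, ·) denote the subgradient curve of f_i emanating from x. Then there exists a closed separable linear subspace H₀ of H such that (i) A ⊆ H₀, and (ii) for every i ∈ ℕ, H₀ is invariant under the subgradient flow of f_i: S_{f_i}(x, t) ∈ H₀ for every x ∈ H₀ and t ≥ 0 (so that S_{f_i}(H₀ × [0, +∞)) = H₀). -/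
open Set Filter MeasureTheory RealInnerProductSpace
open scoped ENNReal NNReal Classical

variable {H : Type*} [NormedAddCommGroup H] [InnerProductSpace ℝ H] [CompleteSpace H]

/-- The convex subdifferential of a real-valued function `f` at `x`. -/
def SubdiffR (f : H → ℝ) (x : H) : Set H :=
  {p | ∀ y, f x + ⟪p, y - x⟫ ≤ f y}

/-- `γ : [0,∞) → H` is the subgradient curve of `f` emanating from `x`:
a locally absolutely continuous curve with `γ 0 = x` and `γ' t ∈ -∂f(γ t)` a.e. -/
def IsSubgradientCurveR (f : H → ℝ) (x : H) (γ : ℝ → H) : Prop :=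
  γ 0 = x ∧ ContinuousOn γ (Set.Ici 0) ∧
  ∃ v : ℝ → H,
    (∀ t > 0, MeasureTheory.IntegrableOn v (Set.Ioc 0 t)) ∧
    (∀ t ≥ 0, γ t = x + ∫ s in Set.Ioc 0 t, v s) ∧
    (∀ᵐ t ∂(MeasureTheory.volume.restrict (Set.Ioi (0:ℝ))), -v t ∈ SubdiffR f (γ t))

theorem setIntegral_Ioc_eq_add {E : Type*} [NormedAddCommGroup E] [NormedSpace ℝ E] {g : ℝ → E}
    {a s t : ℝ} (has : a ≤ s) (hst : s ≤ t) (hg : IntegrableOn g (Ioc a t)) :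
    ∫ r in Ioc a t, g r = (∫ r in Ioc a s, g r) + ∫ r in Ioc s t, g r := by
  rw [← Ioc_union_Ioc_eq_Ioc has hst]
  exact setIntegral_union (Ioc_disjoint_Ioc_of_le le_rfl) measurableSet_Ioc
    (hg.mono_set (Ioc_subset_Ioc_right hst)) (hg.mono_set (Ioc_subset_Ioc_left has))

/-- If `u` is an integrable derivative of `w` with `⟪u t, w t⟫ ≤ 0` almost everywhere, then the
increment of `‖w‖²` over `[s, t]` is controlled by the oscillation of `w` there. -/
theorem norm_sq_sub_norm_sq_le_of_inner_nonpos {w u : ℝ → H} {s t ε : ℝ} (hst : s ≤ t)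
    (hu : IntegrableOn u (Ioc s t)) (hwu : w t - w s = ∫ r in Ioc s t, u r)
    (hle : ∀ᵐ r ∂volume.restrict (Ioc s t), ⟪u r, w r⟫ ≤ 0)
    (hosc : ∀ r ∈ Icc s t, ∀ r' ∈ Icc s t, ‖w r - w r'‖ ≤ ε) :
    ‖w t‖ ^ 2 - ‖w s‖ ^ 2 ≤ 2 * ε * ∫ r in Ioc s t, ‖u r‖ := by
  have h₁ : ‖w t‖ ^ 2 - ‖w s‖ ^ 2 = ∫ r in Ioc s t, ⟪w t + w s, u r⟫ := by
    rw [integral_inner hu, ← hwu, ← real_inner_self_eq_norm_sq, ← real_inner_self_eq_norm_sq]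
    simp only [inner_add_left, inner_sub_right, real_inner_comm (w s) (w t)]
    ring
  rw [h₁, ← integral_const_mul]
  refine integral_mono_ae (hu.const_inner _) (hu.norm.const_mul _) ?_
  filter_upwards [hle, ae_restrict_mem measurableSet_Ioc] with r hr hrm
  have hr' : r ∈ Icc s t := Ioc_subset_Icc_self hrm
  have h₂ : ⟪w t + w s, u r⟫ = ⟪w t - w r, u r⟫ + ⟪w s - w r, u r⟫ + 2 * ⟪u r, w r⟫ := by
    rw [real_inner_comm (w r) (u r)]
    simp only [inner_add_left, inner_sub_left]
    ring
  have h₃ : ∀ q ∈ Icc s t, ⟪w q - w r, u r⟫ ≤ ε * ‖u r‖ := fun q hq =>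
    (real_inner_le_norm _ _).trans
      (mul_le_mul_of_nonneg_right (hosc q hq r hr') (norm_nonneg _))
  have := h₃ t (right_mem_Icc.2 hst)
  have := h₃ s (left_mem_Icc.2 hst)
  rw [h₂]
  linarith

/-- A locally absolutely continuous curve `w` with `⟪w', w⟫ ≤ 0` almost everywhere stays in the
ball of radius `‖w 0‖`. -/
theorem norm_le_norm_zero_of_inner_nonpos {w u : ℝ → H} (hw : ContinuousOn w (Ici 0))
    (hu : ∀ t > 0, IntegrableOn u (Ioc 0 t))
    (hwu : ∀ t ≥ 0, w t = w 0 + ∫ r in Ioc 0 t, u r)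
    (hle : ∀ᵐ r ∂volume.restrict (Ioi (0 : ℝ)), ⟪u r, w r⟫ ≤ 0) {T : ℝ} (hT : 0 ≤ T) :
    ‖w T‖ ≤ ‖w 0‖ := by
  rcases hT.eq_or_lt with rfl | hT
  · rfl
  have key : ∀ ε > 0, ‖w T‖ ^ 2 ≤ ‖w 0‖ ^ 2 + 2 * ε * ∫ r in Ioc 0 T, ‖u r‖ := by
    intro ε hε
    obtain ⟨δ, hδ, hosc⟩ := Metric.uniformContinuousOn_iff_le.1
      ((isCompact_Icc (a := (0 : ℝ)) (b := T)).uniformContinuousOn_of_continuous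
        (hw.mono Icc_subset_Ici_self)) ε hε
    obtain ⟨N, hN⟩ := exists_nat_gt (T / δ)
    have hN₀ : (0 : ℝ) < N := (div_pos hT hδ).trans hN
    have hstep : T / N ≤ δ := by
      rw [div_le_iff₀ hN₀]
      rw [div_lt_iff₀ hδ] at hN
      linarith
    have hind : ∀ n : ℕ, n ≤ N →
        ‖w (n * (T / N))‖ ^ 2 ≤ ‖w 0‖ ^ 2 + 2 * ε * ∫ r in Ioc 0 (n * (T / N)), ‖u r‖ := by
      intro n
      induction n with
      | zero => simp
      | succ n ih =>
        intro hn
        have hTN : 0 < T / N := div_pos hT hN₀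
        set s : ℝ := n * (T / N) with hs
        have hst : ((n + 1 : ℕ) : ℝ) * (T / N) = s + T / N := by rw [hs]; push_cast; ring
        have hs₀ : 0 ≤ s := by positivity
        have htT : s + T / N ≤ T := by
          rw [← hst]
          calc ((n + 1 : ℕ) : ℝ) * (T / N) ≤ N * (T / N) := by gcongr
            _ = T := by field_simp
        rw [hst]
        have hle' : s ≤ s + T / N := by linarith
        have hut := hu (s + T / N) (by linarith)
        have hinc := norm_sq_sub_norm_sq_le_of_inner_nonpos (w := w) (ε := ε) hle'
          (hut.mono_set (Ioc_subset_Ioc_left hs₀))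
          (by
            rw [hwu _ (hs₀.trans hle'), hwu s hs₀, setIntegral_Ioc_eq_add hs₀ hle' hut]
            abel)
          (ae_restrict_of_ae_restrict_of_subset
            (fun r hr => hs₀.trans_lt hr.1) hle)
          (fun r hr r' hr' => by
            rw [← dist_eq_norm]
            refine hosc r ⟨hs₀.trans hr.1, hr.2.trans htT⟩ r' ⟨hs₀.trans hr'.1, hr'.2.trans htT⟩ ?_
            rw [Real.dist_eq, abs_le]
            constructor <;> linarith [hr.1, hr.2, hr'.1, hr'.2])
        rw [setIntegral_Ioc_eq_add hs₀ hle' hut.norm]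
        linarith [ih (by omega)]
    simpa [mul_div_cancel₀ T hN₀.ne'] using hind N le_rfl
  have hlim : Tendsto (fun ε : ℝ => ‖w 0‖ ^ 2 + 2 * ε * ∫ r in Ioc 0 T, ‖u r‖)
      (nhdsWithin 0 (Ioi 0)) (nhds (‖w 0‖ ^ 2)) := by
    refine tendsto_nhdsWithin_of_tendsto_nhds (Continuous.tendsto' (by fun_prop) _ _ (by simp))
  have := ge_of_tendsto hlim (eventually_nhdsWithin_of_forall key)
  exact (sq_le_sq₀ (norm_nonneg _) (norm_nonneg _)).1 this

/-- The convex subdifferential is a monotone operator. -/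
theorem inner_sub_nonneg_of_mem_subdiffR {E : Type*} [NormedAddCommGroup E]
    [InnerProductSpace ℝ E] {f : E → ℝ} {x y p q : E} (hp : p ∈ SubdiffR f x) (hq : q ∈ SubdiffR f y) : 0 ≤ ⟪p - q, x - y⟫ := by
  have h₁ := hp y
  have h₂ := hq x
  have h₃ : ⟪p - q, x - y⟫ = -⟪p, y - x⟫ - ⟪q, x - y⟫ := by
    simp only [inner_sub_left, inner_sub_right]
    ring
  linarith

/-- Subgradient curves are nonexpansive with respect to the initial point. -/
theorem IsSubgradientCurveR.norm_sub_le {f : H → ℝ} {x y : H} {γ η : ℝ → H}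
    (hγ : IsSubgradientCurveR f x γ) (hη : IsSubgradientCurveR f y η) {t : ℝ} (ht : 0 ≤ t) :
    ‖γ t - η t‖ ≤ ‖x - y‖ := by
  obtain ⟨hγ₀, hγc, v, hv, hγv, hvf⟩ := hγ
  obtain ⟨hη₀, hηc, v', hv', hηv, hvf'⟩ := hη
  have := norm_le_norm_zero_of_inner_nonpos (w := γ - η) (u := v - v') (hγc.sub hηc)
    (fun t ht => (hv t ht).sub (hv' t ht))
    (by
      intro t ht
      rcases ht.eq_or_lt with rfl | ht'
      · simp
      · simp only [Pi.sub_apply]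
        rw [integral_sub (hv t ht') (hv' t ht'), hγv t ht, hηv t ht, hγ₀, hη₀]
        abel)
    (by
      filter_upwards [hvf, hvf'] with r hr hr'
      have h := inner_sub_nonneg_of_mem_subdiffR hr hr'
      rw [neg_sub_neg, ← neg_sub (v r), inner_neg_left] at h
      simpa using h) ht
  simpa [hγ₀, hη₀] using this

/-- A subgradient flow, extended by its initial point to negative times, is jointly continuous. -/
theorem continuous_subgradientFlow {f : H → ℝ} {S : H → ℝ → H}
    (hS : ∀ x, IsSubgradientCurveR f x (S x)) :
    Continuous fun p : H × ℝ => S p.1 (max p.2 0) := by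
  refine continuous_prod_of_continuous_lipschitzWith _ 1 (fun x => ?_) (fun t => ?_)
  · exact (hS x).2.1.comp_continuous (by fun_prop) fun t => le_max_right t 0
  · refine LipschitzWith.of_dist_le_mul fun x y => ?_
    simpa [dist_eq_norm] using (hS x).norm_sub_le (hS y) (le_max_right t 0)

/-- Every separable set is contained in a closed separable subspace that is invariant under
countably many given continuous maps depending on a parameter in a separable space. -/
theorem exists_isClosed_isSeparable_submodule_invariant {E P ι : Type*} [NormedAddCommGroup E]
    [NormedSpace ℝ E] [TopologicalSpace P] [TopologicalSpace.SeparableSpace P] [Countable ι]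
    {Φ : ι → E × P → E} (hΦ : ∀ i, Continuous (Φ i)) {A : Set E}
    (hA : TopologicalSpace.IsSeparable A) :
    ∃ K : Submodule ℝ E, IsClosed (K : Set E) ∧ TopologicalSpace.IsSeparable (K : Set E) ∧
      A ⊆ K ∧ ∀ i, ∀ x ∈ K, ∀ p, Φ i (x, p) ∈ K := by
  let step : Submodule ℝ E → Submodule ℝ E := fun V =>
    V ⊔ Submodule.span ℝ (⋃ i, Φ i '' ((V : Set E) ×ˢ univ))
  let V : ℕ → Submodule ℝ E := fun n => step^[n] (Submodule.span ℝ A)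
  have hVs : ∀ n, V (n + 1) = step (V n) := fun n => Function.iterate_succ_apply' _ _ _
  have hmono : Monotone V := monotone_nat_of_le_succ fun n => (hVs n).symm ▸ le_sup_left
  have hsep : ∀ n, TopologicalSpace.IsSeparable (V n : Set E) := by
    intro n
    induction n with
    | zero => exact hA.span
    | succ n ih =>
      have hU : TopologicalSpace.IsSeparable
          ((V n : Set E) ∪ ⋃ i, Φ i '' ((V n : Set E) ×ˢ univ)) :=
        ih.union (.iUnion fun i => (ih.prod (.of_separableSpace _)).image (hΦ i))
      have := hU.span (R := ℝ)
      rw [Submodule.span_union, Submodule.span_eq] at this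
      rwa [hVs n]
  have hcoe : ((⨆ n, V n : Submodule ℝ E) : Set E) = ⋃ n, (V n : Set E) :=
    Submodule.coe_iSup_of_chain ⟨V, hmono⟩
  refine ⟨(⨆ n, V n).topologicalClosure, Submodule.isClosed_topologicalClosure _, ?_, ?_, ?_⟩
  · rw [Submodule.topologicalClosure_coe, hcoe]
    exact (TopologicalSpace.IsSeparable.iUnion hsep).closure
  · exact Submodule.subset_span.trans <| SetLike.coe_subset_coe.2 <|
      (le_iSup V 0).trans (Submodule.le_topologicalClosure _)
  · intro i x hx p
    refine map_mem_closure (f := fun x => Φ i (x, p)) (by fun_prop) hx fun y hy => ?_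
    change y ∈ ((⨆ n, V n : Submodule ℝ E) : Set E) at hy
    change Φ i (y, p) ∈ ((⨆ n, V n : Submodule ℝ E) : Set E)
    rw [hcoe, mem_iUnion] at hy ⊢
    obtain ⟨n, hn⟩ := hy
    refine ⟨n + 1, ?_⟩
    rw [hVs n]
    exact le_sup_right (a := V n) <| Submodule.subset_span <|
      mem_iUnion.2 ⟨i, mem_image_of_mem _ ⟨hn, mem_univ p⟩⟩

/-- **Separable reduction of subgradient flows.**
Given countably many continuous convex functions `f i : H → ℝ` with subgradient flows
`S i`, and a nonempty separable set `A ⊆ H`, there is a closed separable linear subspace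
`H₀` of `H` containing `A` such that for every `i`, the image of `H₀ × [0, ∞)` under the
flow `S i` is exactly `H₀` (in particular `H₀` is invariant under every flow `S i`). -/
theorem separable_reduction_of_subgradient_flows
    (f : ℕ → H → ℝ)
    (hconv : ∀ i, ConvexOn ℝ Set.univ (f i)) (hcont : ∀ i, Continuous (f i))
    (S : ℕ → H → ℝ → H)
    (hS : ∀ i x, IsSubgradientCurveR (f i) x (S i x))
    (A : Set H) (hA : A.Nonempty) (hAsep : TopologicalSpace.IsSeparable A) :
    ∃ H₀ : Submodule ℝ H, IsClosed (H₀ : Set H) ∧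
      TopologicalSpace.IsSeparable (H₀ : Set H) ∧ A ⊆ (H₀ : Set H) ∧
      ∀ i, (fun p : H × ℝ => S i p.1 p.2) '' ((H₀ : Set H) ×ˢ Set.Ici (0:ℝ))
        = (H₀ : Set H) := by
  obtain ⟨K, hKc, hKs, hAK, hK⟩ := exists_isClosed_isSeparable_submodule_invariant
    (fun i => continuous_subgradientFlow (hS i)) hAsep
  refine ⟨K, hKc, hKs, hAK, fun i => Subset.antisymm ?_ fun x hx => ?_⟩
  · rintro _ ⟨⟨x, t⟩, ⟨hx, ht⟩, rfl⟩
    simpa [max_eq_left (mem_Ici.1 ht)] using hK i x hx t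
  · exact ⟨(x, 0), ⟨hx, self_mem_Ici⟩, (hS i x).1⟩
end

section
/- Let H be a real Hilbert space, f : H → ℝ a convex continuous function, and H₀ a closed linear subspace of H that is invariant under the subgradient flow of f (i.e., every subgradient curve of f starting at a point of H₀ remains in H₀). Then for every x ∈ H₀, the metric slope of f at x equals the metric slope of the restriction f|_{H₀} at x: s[f](x) = s[f|_{H₀}](x). -/
open Set Filter MeasureTheory RealInnerProductSpace
open scoped ENNReal NNReal Classical

variable {H : Type*} [NormedAddCommGroup H] [InnerProductSpace ℝ H] [CompleteSpace H]

/-- The metric slope of `f` at `x` relative to a set `S`: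
`limsup_{S \ {x} ∋ y → x} (f x - f y)⁺ / dist x y`, valued in `[0, ∞]`. -/
noncomputable def mslopeOn (f : H → ℝ) (S : Set H) (x : H) : ℝ≥0∞ :=
  Filter.limsup (fun y => ENNReal.ofReal ((f x - f y) / dist x y)) (nhdsWithin x (S \ {x}))

/-- A decreasing sequence of nonempty closed convex bounded sets in a Hilbert space has a common
point. -/
theorem nonempty_iInter_of_antitone_convex {E : Type*} [NormedAddCommGroup E]
    [InnerProductSpace ℝ E] [CompleteSpace E] (K : ℕ → Set E) (hanti : Antitone K)
    (hconvex : ∀ n, Convex ℝ (K n)) (hclosed : ∀ n, IsClosed (K n)) (hne : ∀ n, (K n).Nonempty)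
    (hbdd : Bornology.IsBounded (K 0)) : ∃ p, ∀ n, p ∈ K n := by
  have hmin : ∀ n, ∃ p ∈ K n, ∀ w ∈ K n, ‖p‖ ^ 2 ≤ ⟪p, w⟫ := by
    intro n
    obtain ⟨p, hp, hpe⟩ :=
      exists_norm_eq_iInf_of_complete_convex (hne n) (hclosed n).isComplete (hconvex n) 0
    refine ⟨p, hp, fun w hw => ?_⟩
    have := (norm_eq_iInf_iff_real_inner_le_zero (hconvex n) hp).1 hpe w hw
    rw [zero_sub, inner_neg_left, inner_sub_right, real_inner_self_eq_norm_sq] at this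
    linarith
  choose p hpK hp using hmin
  have hdist : ∀ {n m}, n ≤ m → ‖p m - p n‖ ^ 2 ≤ ‖p m‖ ^ 2 - ‖p n‖ ^ 2 := by
    intro n m hnm
    have h1 := hp n (p m) (hanti hnm (hpK m))
    have h2 := norm_sub_sq_real (p m) (p n)
    rw [real_inner_comm] at h2
    linarith
  obtain ⟨R, hR⟩ := hbdd.exists_norm_le
  have hmono : Monotone fun n => ‖p n‖ ^ 2 := fun n m hnm => by
    have := hdist hnm
    have := sq_nonneg ‖p m - p n‖
    show ‖p n‖ ^ 2 ≤ ‖p m‖ ^ 2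
    linarith
  have hbound : BddAbove (Set.range fun n => ‖p n‖ ^ 2) := by
    refine ⟨R ^ 2, ?_⟩
    rintro _ ⟨n, rfl⟩
    exact pow_le_pow_left₀ (norm_nonneg _) (hR _ (hanti (Nat.zero_le n) (hpK n))) 2
  have hlim := tendsto_atTop_ciSup hmono hbound
  set l := ⨆ n, ‖p n‖ ^ 2
  have hcauchy : CauchySeq p := by
    refine cauchySeq_of_le_tendsto_0 (fun n => 2 * √(l - ‖p n‖ ^ 2)) (fun n m N hn hm => ?_) ?_
    · have key : ∀ k, N ≤ k → ‖p k - p N‖ ≤ √(l - ‖p N‖ ^ 2) := fun k hk => by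
        apply Real.le_sqrt_of_sq_le
        have : ‖p k‖ ^ 2 ≤ l := le_ciSup hbound k
        linarith [hdist hk]
      have := dist_triangle_right (p n) (p m) (p N)
      rw [dist_eq_norm (p n) (p N), dist_eq_norm (p m) (p N)] at this
      linarith [key n hn, key m hm]
    · have : Tendsto (fun n => 2 * √(l - ‖p n‖ ^ 2)) atTop (nhds (2 * √(l - l))) :=
        ((tendsto_const_nhds.sub hlim).sqrt).const_mul 2
      simpa using this
  obtain ⟨q, hq⟩ := cauchySeq_tendsto_of_complete hcauchy
  exact ⟨q, fun n => (hclosed n).mem_of_tendsto hq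
    ((eventually_ge_atTop n).mono fun m hm => hanti hm (hpK m))⟩

/-- A continuous convex function on a normed space has a cone minorant at each point. -/
theorem exists_forall_sub_le_mul_norm_sub {E : Type*} [NormedAddCommGroup E] [NormedSpace ℝ E]
    {f : E → ℝ} (hconv : ConvexOn ℝ Set.univ f) (hcont : Continuous f) (x : E) :
    ∃ L, 0 ≤ L ∧ ∀ y, f x - f y ≤ L * ‖y - x‖ := by
  obtain ⟨r, hr, hball⟩ := Metric.continuousAt_iff.1 (hcont.continuousAt (x := x)) 1 one_pos
  refine ⟨2 / r, by positivity, fun y => ?_⟩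
  rcases eq_or_ne y x with rfl | hyx
  · simp
  have hd : 0 < ‖y - x‖ := norm_pos_iff.2 (sub_ne_zero.2 hyx)
  set d := ‖y - x‖ with hd_def
  set z := x - (r / 2 / d) • (y - x) with hz
  have hzx : dist z x < r := by
    rw [dist_eq_norm, hz, sub_sub_cancel_left, norm_neg, norm_smul, Real.norm_of_nonneg
      (by positivity), ← hd_def, div_mul_cancel₀ _ hd.ne']
    linarith
  have hfz : f z < f x + 1 := by
    have := (abs_lt.1 (hball hzx)).2
    linarith
  have hpos : 0 < r / 2 + d := by positivity
  have hcomb := hconv.2 (Set.mem_univ y) (Set.mem_univ z)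
    (show 0 ≤ r / 2 / (r / 2 + d) by positivity) (show 0 ≤ d / (r / 2 + d) by positivity)
    (by field_simp)
  have hx : (r / 2 / (r / 2 + d)) • y + (d / (r / 2 + d)) • z = x := by
    rw [hz]
    match_scalars
    · field_simp
      ring
    · field_simp
      ring
  rw [hx, smul_eq_mul, smul_eq_mul] at hcomb
  have h2 : (r / 2 + d) * f x ≤ r / 2 * f y + d * f z := by
    calc (r / 2 + d) * f x ≤ (r / 2 + d) * (r / 2 / (r / 2 + d) * f y + d / (r / 2 + d) * f z) := by
          gcongr
      _ = _ := by field_simp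
  have h3 : r / 2 * (f x - f y) ≤ d := by nlinarith
  rw [div_mul_eq_mul_div, le_div_iff₀ hr]
  linarith

/-- The proximal step: a resolvent point of the subdifferential of a continuous convex function. -/
theorem exists_smul_sub_mem_subdiffR {f : H → ℝ} (hconv : ConvexOn ℝ Set.univ f)
    (hcont : Continuous f) {h : ℝ} (hh : 0 < h) (x : H) :
    ∃ y, h⁻¹ • (x - y) ∈ SubdiffR f y := by
  obtain ⟨L, hL, hLx⟩ := exists_forall_sub_le_mul_norm_sub hconv hcont x
  set F : H → ℝ := fun y => 2 * h * f y + ‖y - x‖ ^ 2 with hF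
  have hFcont : Continuous F := by fun_prop
  have hFconv : ConvexOn ℝ Set.univ F := by
    refine (hconv.smul (by positivity : 0 ≤ 2 * h)).add ?_
    have h1 : ConvexOn ℝ Set.univ fun y : H => ‖y - x‖ := by
      simpa [dist_eq_norm] using (convexOn_univ_dist x)
    exact h1.pow (fun _ _ => norm_nonneg _) 2
  have hlow : ∀ y, 2 * h * f x + (‖y - x‖ - h * L) ^ 2 - (h * L) ^ 2 ≤ F y := fun y => by
    have := mul_le_mul_of_nonneg_left (hLx y) (by positivity : 0 ≤ 2 * h)
    simp only [hF]
    nlinarith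
  have hbdd : BddBelow (Set.range F) := by
    refine ⟨2 * h * f x - (h * L) ^ 2, ?_⟩
    rintro _ ⟨y, rfl⟩
    linarith [hlow y, sq_nonneg (‖y - x‖ - h * L)]
  set I := ⨅ y, F y with hI
  obtain ⟨y, hy⟩ := nonempty_iInter_of_antitone_convex
    (fun n : ℕ => {y | F y ≤ I + 1 / ((n : ℝ) + 1)})
    (fun n m hnm y hy => le_trans (show F y ≤ _ from hy) (by gcongr))
    (fun n => by simpa using hFconv.convex_le (I + 1 / ((n : ℝ) + 1)))
    (fun n => isClosed_le hFcont continuous_const)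
    (fun n => by
      obtain ⟨y, hy⟩ := exists_lt_of_ciInf_lt
        (lt_add_of_pos_right I (by positivity : (0 : ℝ) < 1 / ((n : ℝ) + 1)))
      exact ⟨y, hy.le⟩)
    (by
      refine (Metric.isBounded_closedBall (x := x)
        (r := h * L + (I + 1 - 2 * h * f x + (h * L) ^ 2 + 1))).subset fun y hy => ?_
      have h1 : F y ≤ I + 1 := by simpa using hy
      have h2 := hlow y
      rw [Metric.mem_closedBall, dist_eq_norm]
      nlinarith [sq_nonneg (‖y - x‖ - h * L - 1)])
  have hmin : ∀ z, F y ≤ F z := fun z => by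
    refine le_trans ?_ (ciInf_le hbdd z)
    have hlim : Tendsto (fun n : ℕ => I + 1 / ((n : ℝ) + 1)) atTop (nhds I) := by
      simpa using (tendsto_one_div_add_atTop_nhds_zero_nat (𝕜 := ℝ)).const_add I
    exact ge_of_tendsto' hlim hy
  refine ⟨y, fun z => ?_⟩
  have hs : ∀ s ∈ Set.Ioo (0 : ℝ) 1,
      0 ≤ 2 * h * (f z - f y) - 2 * ⟪x - y, z - y⟫ + s * ‖z - y‖ ^ 2 := by
    rintro s ⟨hs0, hs1⟩
    have h1 := hmin (y + s • (z - y))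
    have h2 := hconv.2 (Set.mem_univ y) (Set.mem_univ z) (sub_nonneg.2 hs1.le) hs0.le
      (sub_add_cancel 1 s)
    have h3 : (1 - s) • y + s • z = y + s • (z - y) := by module
    rw [h3, smul_eq_mul, smul_eq_mul] at h2
    have h4 : ‖y + s • (z - y) - x‖ ^ 2
        = ‖y - x‖ ^ 2 - 2 * s * ⟪x - y, z - y⟫ + s ^ 2 * ‖z - y‖ ^ 2 := by
      have : y + s • (z - y) - x = -(x - y) + s • (z - y) := by module
      rw [this, norm_add_sq_real, norm_neg, inner_neg_left, inner_smul_right, norm_smul, mul_pow,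
        Real.norm_eq_abs, sq_abs, norm_sub_rev]
      ring
    simp only [hF, h4] at h1
    have h5 := mul_le_mul_of_nonneg_left h2 (by positivity : 0 ≤ 2 * h)
    have h6 : 0 ≤ s * (2 * h * (f z - f y) - 2 * ⟪x - y, z - y⟫ + s * ‖z - y‖ ^ 2) := by
      nlinarith
    exact nonneg_of_mul_nonneg_right h6 hs0
  have hlim : 0 ≤ 2 * h * (f z - f y) - 2 * ⟪x - y, z - y⟫ + 0 * ‖z - y‖ ^ 2 := by
    have hT : Tendsto (fun s : ℝ => 2 * h * (f z - f y) - 2 * ⟪x - y, z - y⟫ + s * ‖z - y‖ ^ 2)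
        (nhdsWithin 0 (Set.Ioi 0))
        (nhds (2 * h * (f z - f y) - 2 * ⟪x - y, z - y⟫ + 0 * ‖z - y‖ ^ 2)) :=
      (Continuous.tendsto (by fun_prop) 0).mono_left nhdsWithin_le_nhds
    exact ge_of_tendsto hT (Filter.mem_of_superset (Ioo_mem_nhdsGT one_pos) hs)
  rw [inner_smul_left]
  have : h⁻¹ * ⟪x - y, z - y⟫ ≤ f z - f y := by
    rw [inv_mul_le_iff₀ hh]
    linarith
  simp only [conj_trivial]
  linarith

omit [CompleteSpace H] in
/-- The subdifferential is a monotone operator. -/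
theorem inner_sub_nonneg_of_mem_subdiffR_s12 {f : H → ℝ} {a b p q : H} (hp : p ∈ SubdiffR f a)
    (hq : q ∈ SubdiffR f b) : 0 ≤ ⟪p - q, a - b⟫ := by
  have h1 := hp b
  have h2 := hq a
  rw [← neg_sub a b, inner_neg_right] at h1
  rw [inner_sub_left]
  linarith

/-- `X` is an implicit Euler scheme of step `h` for the subgradient flow of `f`, started at `x`. -/
structure IsImplicitEuler (f : H → ℝ) (h : ℝ) (x : H) (X : ℕ → H) : Prop where
  zero : X 0 = x
  mem : ∀ n, h⁻¹ • (X n - X (n + 1)) ∈ SubdiffR f (X (n + 1))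

theorem exists_isImplicitEuler {f : H → ℝ} (hconv : ConvexOn ℝ Set.univ f)
    (hcont : Continuous f) {h : ℝ} (hh : 0 < h) (x : H) : ∃ X, IsImplicitEuler f h x X := by
  choose J hJ using exists_smul_sub_mem_subdiffR hconv hcont hh
  refine ⟨fun n => J^[n] x, rfl, fun n => ?_⟩
  simp only [Function.iterate_succ_apply']
  exact hJ _

namespace IsImplicitEuler

variable {f : H → ℝ} {h : ℝ} {x : H} {X : ℕ → H}

omit [CompleteSpace H]

theorem inner_sub_le (hX : IsImplicitEuler f h x X) (hh : 0 < h) (n : ℕ) (y : H) :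
    ⟪X n - X (n + 1), y - X (n + 1)⟫ ≤ h * (f y - f (X (n + 1))) := by
  have := hX.mem n y
  rw [real_inner_smul_left] at this
  rw [← inv_mul_le_iff₀ hh]
  linarith

theorem sq_norm_sub_le (hX : IsImplicitEuler f h x X) (hh : 0 < h) (n : ℕ) :
    ‖X n - X (n + 1)‖ ^ 2 ≤ h * (f (X n) - f (X (n + 1))) := by
  rw [← real_inner_self_eq_norm_sq]
  exact hX.inner_sub_le hh n (X n)

theorem apply_succ_le (hX : IsImplicitEuler f h x X) (hh : 0 < h) (n : ℕ) :
    f (X (n + 1)) ≤ f (X n) := by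
  have := hX.sq_norm_sub_le hh n
  have : 0 ≤ h * (f (X n) - f (X (n + 1))) := (sq_nonneg _).trans this
  linarith [nonneg_of_mul_nonneg_right this hh]

/-- Discrete evolution variational inequality. -/
theorem sq_norm_sub_sub_le (hX : IsImplicitEuler f h x X) (hh : 0 < h) (n : ℕ) (y : H) :
    ‖X n - y‖ ^ 2 - ‖x - y‖ ^ 2 ≤ 2 * (n * h) * (f y - f (X n)) := by
  induction n with
  | zero => simp [hX.zero]
  | succ n ih =>
    have h1 := hX.inner_sub_le hh n y
    have h2 := hX.apply_succ_le hh n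
    have h3 : ‖X n - y‖ ^ 2 = ‖X n - X (n + 1)‖ ^ 2
        - 2 * ⟪X n - X (n + 1), y - X (n + 1)⟫ + ‖X (n + 1) - y‖ ^ 2 := by
      have : X n - y = (X n - X (n + 1)) - (y - X (n + 1)) := by abel
      rw [this, norm_sub_sq_real, norm_sub_rev y]
    have h4 : (n : ℝ) * h * f (X (n + 1)) ≤ n * h * f (X n) := by gcongr
    push_cast
    nlinarith [sq_nonneg ‖X n - X (n + 1)‖]

/-- Discrete energy inequality. -/
theorem sq_norm_sub_start_le (hX : IsImplicitEuler f h x X) (hh : 0 < h) (n : ℕ) :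
    ‖X n - x‖ ^ 2 ≤ n * h * (f x - f (X n)) := by
  have hsum : ∑ k ∈ Finset.range n, ‖X k - X (k + 1)‖ ^ 2 ≤ h * (f x - f (X n)) := by
    induction n with
    | zero => simp [hX.zero]
    | succ n ih =>
      rw [Finset.sum_range_succ]
      linarith [hX.sq_norm_sub_le hh n]
  have hnorm : ‖X n - x‖ ≤ ∑ k ∈ Finset.range n, ‖X k - X (k + 1)‖ := by
    rw [← hX.zero, norm_sub_rev, ← Finset.sum_range_sub']
    exact norm_sum_le _ _
  calc ‖X n - x‖ ^ 2 ≤ (∑ k ∈ Finset.range n, ‖X k - X (k + 1)‖) ^ 2 := by gcongr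
    _ ≤ n * ∑ k ∈ Finset.range n, ‖X k - X (k + 1)‖ ^ 2 := by
      simpa using sq_sum_le_card_mul_sum_sq (s := Finset.range n)
        (f := fun k => ‖X k - X (k + 1)‖)
    _ ≤ n * (h * (f x - f (X n))) := by gcongr
    _ = _ := by ring

/-- The discrete speeds are bounded by the slope at the starting point. -/
theorem norm_inv_smul_sub_le (hX : IsImplicitEuler f h x X) (hh : 0 < h) {M : ℝ} (hM : 0 ≤ M)
    (hxM : ∀ y, f x - f y ≤ M * ‖y - x‖) (n : ℕ) : ‖h⁻¹ • (X n - X (n + 1))‖ ≤ M := by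
  induction n with
  | zero =>
    have h1 := hX.sq_norm_sub_le hh 0
    have h2 := hxM (X 1)
    rw [zero_add, hX.zero] at *
    rw [norm_smul, norm_inv, Real.norm_of_nonneg hh.le, inv_mul_le_iff₀ hh]
    rw [norm_sub_rev] at h2
    rcases (norm_nonneg (x - X 1)).eq_or_lt with h0 | h0
    · rw [← h0]
      positivity
    · nlinarith
  | succ n ih =>
    refine le_trans ?_ ih
    have h1 := inner_sub_nonneg_of_mem_subdiffR_s12 (hX.mem n) (hX.mem (n + 1))
    set p := h⁻¹ • (X n - X (n + 1))
    set q := h⁻¹ • (X (n + 1) - X (n + 1 + 1)) with hq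
    have h2 : X (n + 1) - X (n + 1 + 1) = h • q := by rw [hq, smul_inv_smul₀ hh.ne']
    rw [h2, real_inner_smul_right, inner_sub_left, real_inner_self_eq_norm_sq] at h1
    have h3 := nonneg_of_mul_nonneg_right h1 hh
    have h4 := real_inner_le_norm p q
    rcases (norm_nonneg q).eq_or_lt with h0 | h0
    · rw [← h0]
      positivity
    · nlinarith

theorem norm_sub_le (hX : IsImplicitEuler f h x X) (hh : 0 < h) {M : ℝ} (hM : 0 ≤ M)
    (hxM : ∀ y, f x - f y ≤ M * ‖y - x‖) {m n : ℕ} (hmn : m ≤ n) :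
    ‖X m - X n‖ ≤ (n - m) * (h * M) := by
  induction n, hmn using Nat.le_induction with
  | base => simp
  | succ n hmn ih =>
    have h1 := hX.norm_inv_smul_sub_le hh hM hxM n
    rw [norm_smul, norm_inv, Real.norm_of_nonneg hh.le, inv_mul_le_iff₀ hh] at h1
    have h2 := norm_sub_le_norm_sub_add_norm_sub (X m) (X n) (X (n + 1))
    push_cast
    linarith

/-- Comparison of the schemes of steps `2 * k` and `k`. -/
theorem sq_norm_sub_two_mul_le {k : ℝ} {Y : ℕ → H} (hX : IsImplicitEuler f (2 * k) x X)
    (hY : IsImplicitEuler f k x Y) (hk : 0 < k) {M : ℝ} (hM : 0 ≤ M)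
    (hxM : ∀ y, f x - f y ≤ M * ‖y - x‖) (n : ℕ) :
    ‖X n - Y (2 * n)‖ ^ 2 ≤ n * (2 * k * M) ^ 2 := by
  induction n with
  | zero => simp [hX.zero, hY.zero]
  | succ n ih =>
    have hk2 : 0 < 2 * k := by positivity
    have hp := hX.mem n
    have hq₁ := hY.mem (2 * n)
    have hq₂ := hY.mem (2 * n + 1)
    have hpM := hX.norm_inv_smul_sub_le hk2 hM hxM n
    have hq₁M := hY.norm_inv_smul_sub_le hk hM hxM (2 * n)
    have hq₂M := hY.norm_inv_smul_sub_le hk hM hxM (2 * n + 1)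
    have hXn : X n - X (n + 1) = (2 * k) • ((2 * k)⁻¹ • (X n - X (n + 1))) := by
      rw [smul_inv_smul₀ hk2.ne']
    have hY₁ : Y (2 * n) - Y (2 * n + 1) = k • (k⁻¹ • (Y (2 * n) - Y (2 * n + 1))) := by
      rw [smul_inv_smul₀ hk.ne']
    have hY₂ : Y (2 * n + 1) - Y (2 * n + 1 + 1)
        = k • (k⁻¹ • (Y (2 * n + 1) - Y (2 * n + 1 + 1))) := by
      rw [smul_inv_smul₀ hk.ne']
    rw [show 2 * (n + 1) = 2 * n + 1 + 1 by ring]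
    set p := (2 * k)⁻¹ • (X n - X (n + 1))
    set q₁ := k⁻¹ • (Y (2 * n) - Y (2 * n + 1))
    set q₂ := k⁻¹ • (Y (2 * n + 1) - Y (2 * n + 1 + 1))
    have h₁ := inner_sub_nonneg_of_mem_subdiffR_s12 hp hq₁
    have h₂ := inner_sub_nonneg_of_mem_subdiffR_s12 hp hq₂
    set D := X (n + 1) - Y (2 * n + 1 + 1) with hD
    have h₃ : X (n + 1) - Y (2 * n + 1) = D - k • q₂ := by rw [hD, ← hY₂]; abel
    have h₄ : X n - Y (2 * n) = D + k • ((p - q₁) + (p - q₂)) := by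
      have : k • ((p - q₁) + (p - q₂)) = (2 * k) • p - k • q₁ - k • q₂ := by module
      rw [this, ← hXn, ← hY₁, ← hY₂, hD]
      abel
    have h₅ : -(2 * M ^ 2) ≤ ⟪p - q₁, q₂⟫ := by
      have hpq : ‖p - q₁‖ ≤ 2 * M := (_root_.norm_sub_le p q₁).trans (by linarith)
      have := neg_le_of_abs_le (abs_real_inner_le_norm (p - q₁) q₂)
      have : ‖p - q₁‖ * ‖q₂‖ ≤ 2 * M * M := by gcongr
      linarith
    rw [h₃, inner_sub_right, real_inner_smul_right] at h₁
    rw [h₄, norm_add_sq_real, real_inner_smul_right, inner_add_right, real_inner_comm (p - q₁),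
      real_inner_comm (p - q₂)] at ih
    have h₆ : 0 ≤ ‖k • ((p - q₁) + (p - q₂))‖ ^ 2 := sq_nonneg _
    have h₇ : k * (k * -(2 * M ^ 2)) ≤ k * ⟪p - q₁, D⟫ := by
      gcongr
      nlinarith
    have h₈ : 0 ≤ k * ⟪p - q₂, D⟫ := by positivity
    push_cast
    nlinarith

end IsImplicitEuler

/-- The exponentially weighted Lebesgue measure on the positive half-line. -/
noncomputable def expWeight : Measure ℝ :=
  (volume.restrict (Set.Ioi 0)).withDensity fun t => ENNReal.ofReal (Real.exp (-t))

instance : IsProbabilityMeasure expWeight := by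
  refine ⟨?_⟩
  rw [expWeight, withDensity_apply _ MeasurableSet.univ, Measure.restrict_univ,
    ← ofReal_integral_eq_lintegral_ofReal (integrableOn_exp_neg_Ioi 0)
      (Eventually.of_forall fun t => (Real.exp_pos _).le), integral_exp_neg_Ioi_zero,
    ENNReal.ofReal_one]

theorem restrict_Ioi_absolutelyContinuous_expWeight :
    volume.restrict (Set.Ioi (0 : ℝ)) ≪ expWeight :=
  withDensity_absolutelyContinuous' (by fun_prop)
    (Eventually.of_forall fun t => (ENNReal.ofReal_pos.2 (Real.exp_pos _)).ne')

theorem restrict_Ioc_le_smul_expWeight (t : ℝ) :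
    volume.restrict (Set.Ioc 0 t) ≤ ENNReal.ofReal (Real.exp t) • expWeight := by
  refine Measure.le_iff.2 fun s hs => ?_
  rw [Measure.smul_apply, expWeight, withDensity_apply _ hs, smul_eq_mul,
    ← lintegral_const_mul _ (by fun_prop), Measure.restrict_restrict hs, Measure.restrict_apply hs,
    ← setLIntegral_one]
  calc ∫⁻ _ in s ∩ Set.Ioc 0 t, 1
      ≤ ∫⁻ r in s ∩ Set.Ioc 0 t, ENNReal.ofReal (Real.exp t) * ENNReal.ofReal (Real.exp (-r)) := by
        refine setLIntegral_mono (by fun_prop) fun r hr => ?_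
        rw [← ENNReal.ofReal_mul (Real.exp_pos _).le, ← Real.exp_add, ENNReal.one_le_ofReal]
        exact Real.one_le_exp (by linarith [hr.2.2])
    _ ≤ _ := lintegral_mono_set (Set.inter_subset_inter_right _ Set.Ioc_subset_Ioi_self)

section Lp

variable {E : Type*} [NormedAddCommGroup E]

theorem restrict_Ioc_absolutelyContinuous_expWeight (t : ℝ) :
    volume.restrict (Set.Ioc 0 t) ≪ expWeight :=
  (Measure.absolutelyContinuous_of_le (Measure.restrict_mono_set _ Set.Ioc_subset_Ioi_self)).trans
    restrict_Ioi_absolutelyContinuous_expWeight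

theorem integrableOn_Ioc_of_lp_expWeight (g : Lp E 2 expWeight) (t : ℝ) :
    IntegrableOn g (Set.Ioc 0 t) := by
  rw [IntegrableOn, ← memLp_one_iff_integrable]
  exact ((Lp.memLp g).mono_exponent (by norm_num)).of_measure_le_smul ENNReal.ofReal_ne_top
    (restrict_Ioc_le_smul_expWeight t)

theorem isClosed_setOf_ae_mem {α : Type*} [MeasurableSpace α] {μ : Measure α} {S : α → Set E}
    (hS : ∀ t, IsClosed (S t)) : IsClosed {g : Lp E 2 μ | ∀ᵐ t ∂μ, g t ∈ S t} := by
  refine IsSeqClosed.isClosed fun u g hu hug => ?_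
  obtain ⟨φ, -, hφ⟩ := (tendstoInMeasure_of_tendsto_Lp hug).exists_seq_tendsto_ae
  have hu' : ∀ᵐ t ∂μ, ∀ n, u n t ∈ S t := ae_all_iff.2 hu
  show ∀ᵐ t ∂μ, g t ∈ S t
  filter_upwards [hφ, hu'] with t ht ht'
  exact (hS t).mem_of_tendsto ht (Eventually.of_forall fun n => ht' _)

variable [NormedSpace ℝ E]

theorem norm_integral_Ioc_le_of_lp_expWeight (g : Lp E 2 expWeight) (t : ℝ) :
    ‖∫ s in Set.Ioc 0 t, g s‖ ≤ Real.exp t * ‖g‖ := by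
  have h : ‖∫ s in Set.Ioc 0 t, g s‖ₑ ≤ ENNReal.ofReal (Real.exp t) * eLpNorm g 2 expWeight :=
    calc ‖∫ s in Set.Ioc 0 t, g s‖ₑ ≤ eLpNorm g 1 (volume.restrict (Set.Ioc 0 t)) := by
          rw [eLpNorm_one_eq_lintegral_enorm]
          exact enorm_integral_le_lintegral_enorm _
      _ ≤ eLpNorm g 1 (ENNReal.ofReal (Real.exp t) • expWeight) :=
          eLpNorm_mono_measure _ (restrict_Ioc_le_smul_expWeight t)
      _ = ENNReal.ofReal (Real.exp t) * eLpNorm g 1 expWeight := by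
          simp [eLpNorm_smul_measure_of_ne_top]
      _ ≤ _ := by
          gcongr
          exact eLpNorm_le_eLpNorm_of_exponent_le (by norm_num) (Lp.memLp g).1
  rw [← enorm_norm, Real.enorm_of_nonneg (norm_nonneg _)] at h
  rw [Lp.norm_def, ← ENNReal.toReal_ofReal (Real.exp_pos t).le, ← ENNReal.toReal_mul,
    ← ENNReal.ofReal_le_iff_le_toReal]
  · exact h
  · exact ENNReal.mul_ne_top ENNReal.ofReal_ne_top (Lp.eLpNorm_ne_top g)

/-- Integration over `(0, t]` as a continuous linear map on the weighted `L²` space. -/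
noncomputable def integralIocCLM (E : Type*) [NormedAddCommGroup E] [NormedSpace ℝ E] (t : ℝ) :
    Lp E 2 expWeight →L[ℝ] E :=
  LinearMap.mkContinuous
    { toFun := fun g => ∫ s in Set.Ioc 0 t, g s
      map_add' := fun g₁ g₂ => by
        rw [← integral_add (integrableOn_Ioc_of_lp_expWeight g₁ t)
          (integrableOn_Ioc_of_lp_expWeight g₂ t)]
        exact integral_congr_ae
          ((restrict_Ioc_absolutelyContinuous_expWeight t).ae_le (Lp.coeFn_add g₁ g₂))
      map_smul' := fun c g => by
        rw [RingHom.id_apply, ← integral_smul]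
        exact integral_congr_ae
          ((restrict_Ioc_absolutelyContinuous_expWeight t).ae_le (Lp.coeFn_smul c g)) }
    (Real.exp t) fun g => norm_integral_Ioc_le_of_lp_expWeight g t

theorem integralIocCLM_apply (t : ℝ) (g : Lp E 2 expWeight) :
    integralIocCLM E t g = ∫ s in Set.Ioc 0 t, g s := rfl

theorem convex_setOf_ae_mem {α : Type*} [MeasurableSpace α] {μ : Measure α} {S : α → Set E}
    (hS : ∀ t, Convex ℝ (S t)) : Convex ℝ {g : Lp E 2 μ | ∀ᵐ t ∂μ, g t ∈ S t} := by
  intro g₁ h₁ g₂ h₂ a b ha hb hab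
  have h₁' : ∀ᵐ t ∂μ, g₁ t ∈ S t := h₁
  have h₂' : ∀ᵐ t ∂μ, g₂ t ∈ S t := h₂
  show ∀ᵐ t ∂μ, (a • g₁ + b • g₂ : Lp E 2 μ) t ∈ S t
  filter_upwards [h₁', h₂', Lp.coeFn_add (a • g₁) (b • g₂), Lp.coeFn_smul a g₁, Lp.coeFn_smul b g₂]
    with t ht₁ ht₂ h h' h''
  rw [h, Pi.add_apply, h', h'']
  exact hS t ht₁ ht₂ ha hb hab

end Lp

/-- Weak compactness of uniformly bounded velocities: some function lies almost everywhere in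
the closed convex hulls of all tails, and its primitive is the limit of the primitives. -/
theorem exists_ae_mem_closedConvexHull {v : ℕ → ℝ → H} {M : ℝ}
    (hv : ∀ m, StronglyMeasurable (v m)) (hM : ∀ m t, ‖v m t‖ ≤ M) :
    ∃ w : ℝ → H, (∀ t, IntegrableOn w (Set.Ioc 0 t)) ∧
      (∀ᵐ t ∂(volume.restrict (Set.Ioi (0 : ℝ))), ∀ n,
        w t ∈ closedConvexHull ℝ {z | ∃ m, n ≤ m ∧ z = v m t}) ∧
      ∀ t z, Tendsto (fun m => ∫ s in Set.Ioc 0 t, v m s) atTop (nhds z) →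
        ∫ s in Set.Ioc 0 t, w s = z := by
  have hmem : ∀ m, MemLp (v m) 2 expWeight := fun m =>
    MemLp.of_bound (hv m).aestronglyMeasurable M (Eventually.of_forall (hM m))
  set g : ℕ → Lp H 2 expWeight := fun m => (hmem m).toLp (v m) with hg
  have hgv : ∀ m, g m =ᵐ[expWeight] v m := fun m => (hmem m).coeFn_toLp
  have hM0 : 0 ≤ M := (norm_nonneg _).trans (hM 0 0)
  have hgM : ∀ m, ‖g m‖ ≤ M := fun m => by
    have := Lp.norm_le_of_ae_bound (f := g m) hM0 ((hgv m).mono fun t ht => by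
      rw [ht]
      exact hM m t)
    simpa [measureUnivNNReal] using this
  obtain ⟨w, hw⟩ := nonempty_iInter_of_antitone_convex
    (fun n => closedConvexHull ℝ {z | ∃ m, n ≤ m ∧ z = g m})
    (fun n n' hn => (closedConvexHull ℝ).monotone fun z ⟨m, hm, hz⟩ => ⟨m, hn.trans hm, hz⟩)
    (fun n => convex_closedConvexHull) (fun n => isClosed_closedConvexHull)
    (fun n => ⟨g n, subset_closedConvexHull ⟨n, le_rfl, rfl⟩⟩)
    ((Metric.isBounded_closedBall (x := 0) (r := M)).subset
      (closedConvexHull_min (by rintro _ ⟨m, -, rfl⟩; simpa using hgM m)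
        (convex_closedBall _ _) Metric.isClosed_closedBall))
  refine ⟨w, integrableOn_Ioc_of_lp_expWeight w,
    restrict_Ioi_absolutelyContinuous_expWeight.ae_le (ae_all_iff.2 fun n => ?_), fun t z hz => ?_⟩
  · refine closedConvexHull_min ?_ (convex_setOf_ae_mem fun _ => convex_closedConvexHull)
      (isClosed_setOf_ae_mem fun _ => isClosed_closedConvexHull) (hw n)
    rintro _ ⟨m, hm, rfl⟩
    exact (hgv m).mono fun t ht => subset_closedConvexHull ⟨m, hm, ht⟩
  · rw [← integralIocCLM_apply]
    refine eq_of_forall_dist_le fun ε hε => ?_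
    obtain ⟨N, hN⟩ := Metric.tendsto_atTop.1 hz ε hε
    refine closedConvexHull_min (t := integralIocCLM H t ⁻¹' Metric.closedBall z ε) ?_
      ((convex_closedBall _ _).linear_preimage (integralIocCLM H t).toLinearMap)
      (Metric.isClosed_closedBall.preimage (integralIocCLM H t).continuous) (hw N)
    rintro _ ⟨m, hm, rfl⟩
    rw [Set.mem_preimage, integralIocCLM_apply, integral_congr_ae
      ((restrict_Ioc_absolutelyContinuous_expWeight t).ae_le (hgv m))]
    exact (hN m hm).le

/-- The integral of a step function with values `h⁻¹ • (X (n + 1) - X n)` telescopes. -/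
theorem norm_add_integral_step_sub_le {E : Type*} [NormedAddCommGroup E] [NormedSpace ℝ E]
    [CompleteSpace E] {h M : ℝ} (hh : 0 < h) (X : ℕ → E)
    (hX : ∀ n, ‖h⁻¹ • (X (n + 1) - X n)‖ ≤ M) {t : ℝ} (ht : 0 ≤ t) :
    ‖X 0 + (∫ s in Set.Ioc 0 t, h⁻¹ • (X (⌊s / h⌋₊ + 1) - X ⌊s / h⌋₊)) - X ⌊t / h⌋₊‖
      ≤ h * M := by
  set v : ℝ → E := fun s => h⁻¹ • (X (⌊s / h⌋₊ + 1) - X ⌊s / h⌋₊) with hv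
  have hM0 : 0 ≤ M := (norm_nonneg _).trans (hX 0)
  have hmeas : StronglyMeasurable v := by
    have : StronglyMeasurable fun n : ℕ => h⁻¹ • (X (n + 1) - X n) := .of_discrete
    exact this.comp_measurable (Nat.measurable_floor.comp (measurable_id.div_const h))
  have hint : ∀ a b, IntervalIntegrable v volume a b := fun a b =>
    (intervalIntegrable_const (c := M)).mono_fun hmeas.aestronglyMeasurable
      (Eventually.of_forall fun s => by
        rw [Real.norm_of_nonneg hM0]
        exact hX _)
  have hsum : ∀ n : ℕ, X 0 + ∫ s in (0 : ℝ)..(n * h), v s = X n := by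
    intro n
    induction n with
    | zero => simp
    | succ n ih =>
      rw [← intervalIntegral.integral_add_adjacent_intervals (hint 0 (n * h)) (hint _ _),
        ← add_assoc, ih]
      have hconst : ∫ s in (n * h : ℝ)..((n + 1 : ℕ) * h), v s
          = ∫ s in (n * h : ℝ)..((n + 1 : ℕ) * h), h⁻¹ • (X (n + 1) - X n) := by
        rw [intervalIntegral.integral_of_le (by push_cast; nlinarith),
          intervalIntegral.integral_of_le (by push_cast; nlinarith),
          ← integral_Ico_eq_integral_Ioc, ← integral_Ico_eq_integral_Ioc]
        refine setIntegral_congr_fun measurableSet_Ico fun s hs => ?_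
        have : ⌊s / h⌋₊ = n := by
          have hs0 : 0 ≤ s := le_trans (by positivity) hs.1
          rw [Nat.floor_eq_iff (by positivity), le_div_iff₀ hh, div_lt_iff₀ hh]
          exact_mod_cast hs
        simp only [hv, this]
      rw [hconst, intervalIntegral.integral_const, smul_smul]
      have : (((n + 1 : ℕ) : ℝ) * h - n * h) * h⁻¹ = 1 := by
        push_cast
        field_simp
        ring
      rw [this, one_smul]
      abel
  have hfloor : (⌊t / h⌋₊ : ℝ) * h ≤ t := by
    rw [← le_div_iff₀ hh]
    exact Nat.floor_le (by positivity)
  have hfloor' : t < (⌊t / h⌋₊ + 1 : ℝ) * h := by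
    rw [← div_lt_iff₀ hh]
    exact Nat.lt_floor_add_one _
  rw [← intervalIntegral.integral_of_le ht, ← hsum ⌊t / h⌋₊,
    ← intervalIntegral.integral_add_adjacent_intervals (hint 0 (⌊t / h⌋₊ * h)) (hint _ t),
    ← add_assoc, add_sub_cancel_left]
  refine (intervalIntegral.norm_integral_le_of_norm_le_const fun s _ => hX _).trans ?_
  rw [abs_of_nonneg (by linarith), mul_comm]
  gcongr
  linarith

/-- The subgradient curve emanating from any point exists, and it satisfies the evolution
variational inequality and the energy inequality. -/
theorem exists_isSubgradientCurveR {f : H → ℝ} (hconv : ConvexOn ℝ Set.univ f)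
    (hcont : Continuous f) (x : H) :
    ∃ γ, IsSubgradientCurveR f x γ ∧ ∀ t ≥ (0 : ℝ),
      (∀ y, ‖γ t - y‖ ^ 2 - ‖x - y‖ ^ 2 ≤ 2 * t * (f y - f (γ t))) ∧
      ‖γ t - x‖ ^ 2 ≤ t * (f x - f (γ t)) := by
  obtain ⟨M, hM, hxM⟩ := exists_forall_sub_le_mul_norm_sub hconv hcont x
  set h : ℕ → ℝ := fun m => (1 / 2) ^ m with hh_def
  have hh : ∀ m, 0 < h m := fun m => by positivity
  have hh_lim : Tendsto h atTop (nhds 0) :=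
    tendsto_pow_atTop_nhds_zero_of_lt_one (by norm_num) (by norm_num)
  choose X hX using fun m => exists_isImplicitEuler hconv hcont (hh m) x
  set u : ℕ → ℝ → H := fun m t => X m ⌊t / h m⌋₊ with hu
  have hfloor : ∀ m t, 0 ≤ t → (⌊t / h m⌋₊ : ℝ) * h m ≤ t := fun m t ht => by
    rw [← le_div_iff₀ (hh m)]
    exact Nat.floor_le (div_nonneg ht (hh m).le)
  have hfloor' : ∀ m t, t ≤ (⌊t / h m⌋₊ : ℝ) * h m + h m := fun m t => by
    have : t / h m < ⌊t / h m⌋₊ + 1 := Nat.lt_floor_add_one _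
    rw [div_lt_iff₀ (hh m)] at this
    linarith
  have hfloor_lim : ∀ t, 0 ≤ t → Tendsto (fun m => (⌊t / h m⌋₊ : ℝ) * h m) atTop (nhds t) :=
    fun t ht => tendsto_of_tendsto_of_tendsto_of_le_of_le
      (by simpa using (tendsto_const_nhds (x := t)).sub hh_lim) tendsto_const_nhds
      (fun m => by
        have := hfloor' m t
        show t - h m ≤ _
        linarith)
      (fun m => hfloor m t ht)
  have hstep : ∀ m t, 0 ≤ t → dist (u m t) (u (m + 1) t) ≤ M * (√t + 1) * √(1 / 2) ^ m := by
    intro m t ht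
    have hk : h m = 2 * h (m + 1) := by
      simp only [hh_def, pow_succ]
      ring
    have hr : (√(1 / 2) ^ m) ^ 2 = h m := by
      rw [← pow_mul, mul_comm, pow_mul, Real.sq_sqrt (by norm_num)]
    have hr1 : √(1 / 2 : ℝ) ^ m ≤ 1 :=
      pow_le_one₀ (Real.sqrt_nonneg _) (Real.sqrt_le_one.2 (by norm_num))
    have hr0 : 0 ≤ √(1 / 2 : ℝ) ^ m := by positivity
    have hXm := hX m
    rw [hk] at hXm
    have h1 := hXm.sq_norm_sub_two_mul_le (hX (m + 1)) (hh (m + 1)) hM hxM ⌊t / h m⌋₊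
    rw [← hk] at h1
    have h2 : ‖X m ⌊t / h m⌋₊ - X (m + 1) (2 * ⌊t / h m⌋₊)‖ ≤ M * √t * √(1 / 2) ^ m := by
      refine le_of_sq_le_sq (h1.trans ?_) (by positivity)
      calc (⌊t / h m⌋₊ : ℝ) * (h m * M) ^ 2 = (⌊t / h m⌋₊ * h m) * (h m * M ^ 2) := by ring
        _ ≤ t * (h m * M ^ 2) := by
          have := hfloor m t ht
          have := (hh m).le
          gcongr
        _ = _ := by
          rw [mul_pow, mul_pow, Real.sq_sqrt ht, hr]
          ring
    have hdiv : t / h (m + 1) = 2 * (t / h m) := by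
      rw [hk]
      field_simp [(hh (m + 1)).ne']
    have h3 : 2 * ⌊t / h m⌋₊ ≤ ⌊t / h (m + 1)⌋₊ := by
      rw [hdiv]
      apply Nat.le_floor
      push_cast
      have := Nat.floor_le (div_nonneg ht (hh m).le)
      linarith
    have h4 : (⌊t / h (m + 1)⌋₊ : ℝ) - (2 * ⌊t / h m⌋₊ : ℕ) ≤ 1 := by
      have : ⌊t / h (m + 1)⌋₊ < 2 * ⌊t / h m⌋₊ + 2 := by
        rw [hdiv, Nat.floor_lt (mul_nonneg two_pos.le (div_nonneg ht (hh m).le))]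
        push_cast
        have := Nat.lt_floor_add_one (t / h m)
        linarith
      have : ⌊t / h (m + 1)⌋₊ ≤ 2 * ⌊t / h m⌋₊ + 1 := by omega
      have : (⌊t / h (m + 1)⌋₊ : ℝ) ≤ (2 * ⌊t / h m⌋₊ : ℕ) + 1 := by exact_mod_cast this
      linarith
    have h5 := (hX (m + 1)).norm_sub_le (hh (m + 1)) hM hxM h3
    have h6 : h (m + 1) * M ≤ M * √(1 / 2) ^ m := by
      rw [mul_comm]
      gcongr
      nlinarith [hh (m + 1)]
    have h7 := norm_sub_le_norm_sub_add_norm_sub (X m ⌊t / h m⌋₊)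
      (X (m + 1) (2 * ⌊t / h m⌋₊)) (X (m + 1) ⌊t / h (m + 1)⌋₊)
    rw [dist_eq_norm]
    nlinarith [mul_nonneg (hh (m + 1)).le hM]
  have hlim : ∀ t, ∃ z, 0 ≤ t → Tendsto (fun m => u m t) atTop (nhds z) := by
    intro t
    by_cases ht : 0 ≤ t
    · obtain ⟨z, hz⟩ := cauchySeq_tendsto_of_complete (cauchySeq_of_le_geometric _ _
        ((Real.sqrt_lt' one_pos).2 (by norm_num)) fun m => hstep m t ht)
      exact ⟨z, fun _ => hz⟩
    · exact ⟨0, fun h => absurd h ht⟩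
  choose γ hγ using hlim
  set v : ℕ → ℝ → H := fun m s => (h m)⁻¹ • (X m (⌊s / h m⌋₊ + 1) - X m ⌊s / h m⌋₊) with hv_def
  have hXM : ∀ m n, ‖(h m)⁻¹ • (X m (n + 1) - X m n)‖ ≤ M := fun m n => by
    rw [← neg_sub, smul_neg, norm_neg]
    exact (hX m).norm_inv_smul_sub_le (hh m) hM hxM n
  have hv : ∀ m, StronglyMeasurable (v m) := fun m => by
    have : StronglyMeasurable fun n : ℕ => (h m)⁻¹ • (X m (n + 1) - X m n) := .of_discrete
    exact this.comp_measurable (Nat.measurable_floor.comp (measurable_id.div_const (h m)))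
  obtain ⟨w, hw_int, hw_mem, hw_lim⟩ :=
    exists_ae_mem_closedConvexHull hv (M := M) fun m t => hXM m _
  have hhM_lim : Tendsto (fun m => h m * M) atTop (nhds 0) := by simpa using hh_lim.mul_const M
  have hγ_int : ∀ t ≥ 0, γ t = x + ∫ s in Set.Ioc 0 t, w s := by
    intro t ht
    have h1 : Tendsto (fun m => x + (∫ s in Set.Ioc 0 t, v m s) - u m t) atTop (nhds 0) :=
      squeeze_zero_norm (fun m => by
        have := norm_add_integral_step_sub_le (hh m) (X m) (hXM m) ht
        rwa [(hX m).zero] at this) hhM_lim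
    have h2 := (h1.add (hγ t ht)).sub_const x
    simp only [sub_add_cancel, add_sub_cancel_left, zero_add] at h2
    rw [hw_lim t _ h2]
    abel
  have hγ_lip : ∀ s t, 0 ≤ s → s ≤ t → ‖γ s - γ t‖ ≤ M * (t - s) := by
    intro s t hs hst
    have hT : Tendsto (fun m => M * (t - s) + h m * M) atTop (nhds (M * (t - s))) := by
      simpa using hhM_lim.const_add (M * (t - s))
    refine le_of_tendsto_of_tendsto' ((hγ s hs).sub (hγ t (hs.trans hst))).norm hT fun m => ?_
    have h1 := (hX m).norm_sub_le (hh m) hM hxM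
      (Nat.floor_mono (div_le_div_of_nonneg_right hst (hh m).le))
    have h2 := hfloor m t (hs.trans hst)
    have h3 := hfloor' m s
    refine h1.trans ?_
    nlinarith
  refine ⟨γ, ⟨?_, ?_, w, fun t _ => hw_int t, hγ_int, ?_⟩, fun t ht => ⟨fun y => ?_, ?_⟩⟩
  · simpa using hγ_int 0 le_rfl
  · refine (LipschitzOnWith.of_dist_le_mul (K := ⟨M, hM⟩) fun s hs t ht => ?_).continuousOn
    rw [dist_eq_norm, Real.dist_eq]
    show _ ≤ M * _
    rcases le_total s t with hst | hst
    · rw [abs_sub_comm, abs_of_nonneg (sub_nonneg.2 hst)]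
      exact hγ_lip s t hs hst
    · rw [norm_sub_rev, abs_of_nonneg (sub_nonneg.2 hst)]
      exact hγ_lip t s ht hst
  · filter_upwards [hw_mem, ae_restrict_mem measurableSet_Ioi] with t hwt ht y
    have ht0 : (0 : ℝ) ≤ t := le_of_lt ht
    set U : ℕ → H := fun m => X m (⌊t / h m⌋₊ + 1) with hU
    have hU_lim : Tendsto U atTop (nhds (γ t)) := by
      have h1 : Tendsto (fun m => u m t - U m) atTop (nhds 0) :=
        squeeze_zero_norm (fun m => by
          have := (hX m).norm_sub_le (hh m) hM hxM (Nat.le_succ ⌊t / h m⌋₊)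
          simpa using this) hhM_lim
      simpa using (hγ t ht0).sub h1
    have ha : Tendsto (fun m => f (U m) - M * ‖γ t - U m‖) atTop (nhds (f (γ t))) := by
      have h1 := (hcont.tendsto (γ t)).comp hU_lim
      have h2 := ((tendsto_const_nhds (x := γ t)).sub hU_lim).norm.const_mul M
      simpa using h1.sub h2
    refine le_of_forall_pos_le_add fun ε hε => ?_
    obtain ⟨N, hN⟩ := eventually_atTop.1 (ha.eventually (lt_mem_nhds (sub_lt_self (f (γ t)) hε)))
    have hmem : w t ∈ {z | f (γ t) - ε - f y ≤ (innerSL ℝ (y - γ t)) z} := by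
      refine closedConvexHull_min ?_
        (convex_halfSpace_ge (innerSL ℝ (y - γ t)).toLinearMap.isLinear _)
        (isClosed_le continuous_const (innerSL ℝ (y - γ t)).continuous) (hwt N)
      rintro _ ⟨m, hm, rfl⟩
      have h1 := (hX m).mem ⌊t / h m⌋₊ y
      have h2 : (h m)⁻¹ • (X m ⌊t / h m⌋₊ - X m (⌊t / h m⌋₊ + 1)) = -v m t := by
        rw [← smul_neg, neg_sub]
      have h3 : y - U m = (y - γ t) + (γ t - U m) := by abel
      have h4 := real_inner_le_norm (v m t) (γ t - U m)
      have h5 : ‖v m t‖ * ‖γ t - U m‖ ≤ M * ‖γ t - U m‖ := by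
        gcongr
        exact hXM m _
      rw [h2, h3, inner_neg_left, inner_add_right] at h1
      have h6 := hN m hm
      show _ ≤ ⟪y - γ t, v m t⟫
      rw [real_inner_comm]
      linarith
    have hmem' : f (γ t) - ε - f y ≤ ⟪y - γ t, w t⟫ := hmem
    rw [inner_neg_left, real_inner_comm]
    linarith
  · refine le_of_tendsto_of_tendsto' (((hγ t ht).sub_const y).norm.pow 2 |>.sub_const _)
      (((hfloor_lim t ht).const_mul 2).mul
        (((hcont.tendsto (γ t)).comp (hγ t ht)).const_sub (f y))) fun m => ?_
    exact (hX m).sq_norm_sub_sub_le (hh m) _ y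
  · refine le_of_tendsto_of_tendsto' (((hγ t ht).sub_const x).norm.pow 2)
      ((hfloor_lim t ht).mul
        (((hcont.tendsto (γ t)).comp (hγ t ht)).const_sub (f x))) fun m => ?_
    exact (hX m).sq_norm_sub_start_le (hh m) _

omit [InnerProductSpace ℝ H] [CompleteSpace H] in
theorem mslopeOn_mono (f : H → ℝ) {S T : Set H} (hST : S ⊆ T) (x : H) :
    mslopeOn f S x ≤ mslopeOn f T x :=
  limsup_le_limsup_of_le (nhdsWithin_mono _ (Set.sdiff_subset_sdiff_left hST))

omit [InnerProductSpace ℝ H] [CompleteSpace H] in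
theorem mslopeOn_le_ofReal {f : H → ℝ} {S : Set H} {x : H} {c : ℝ}
    (hc : ∀ y, f x - f y ≤ c * ‖y - x‖) : mslopeOn f S x ≤ ENNReal.ofReal c := by
  refine limsup_le_of_le (h := ?_)
  filter_upwards [self_mem_nhdsWithin] with y hy
  have hyx : 0 < dist x y := dist_pos.2 fun h => hy.2 h.symm
  apply ENNReal.ofReal_le_ofReal
  rw [div_le_iff₀ hyx, dist_comm, dist_eq_norm]
  exact hc y

omit [CompleteSpace H] in
/-- For a convex function, the difference quotients are bounded by the metric slope. -/
theorem sub_le_mslopeOn_toReal_mul {f : H → ℝ} (hconv : ConvexOn ℝ Set.univ f) {S : Set H}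
    (hS : Convex ℝ S) {x y : H} (hx : x ∈ S) (hy : y ∈ S) (hfin : mslopeOn f S x ≠ ∞) :
    f x - f y ≤ (mslopeOn f S x).toReal * ‖y - x‖ := by
  rcases eq_or_ne y x with rfl | hyx
  · simp
  have hd : 0 < ‖y - x‖ := norm_pos_iff.2 (sub_ne_zero.2 hyx)
  rw [← div_le_iff₀ hd, ← ENNReal.ofReal_le_iff_le_toReal hfin]
  have hT : Tendsto (fun s : ℝ => x + s • (y - x)) (nhdsWithin 0 (Set.Ioi 0))
      (nhdsWithin x (S \ {x})) := by
    refine tendsto_nhdsWithin_iff.2 ⟨?_, ?_⟩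
    · have : Tendsto (fun s : ℝ => x + s • (y - x)) (nhds 0) (nhds (x + (0 : ℝ) • (y - x))) :=
        Continuous.tendsto (by fun_prop) 0
      rw [zero_smul, add_zero] at this
      exact this.mono_left nhdsWithin_le_nhds
    · filter_upwards [Ioo_mem_nhdsGT one_pos] with s hs
      refine ⟨hS.add_smul_sub_mem hx hy ⟨hs.1.le, hs.2.le⟩, fun h => ?_⟩
      have h' : s • (y - x) = 0 := by simpa using h
      rcases smul_eq_zero.1 h' with h0 | h0
      · exact hs.1.ne' h0
      · exact hyx (sub_eq_zero.1 h0)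
  refine le_limsup_of_frequently_le (hT.frequently (Eventually.frequently ?_))
  filter_upwards [Ioo_mem_nhdsGT one_pos] with s hs
  have h1 := hconv.2 (Set.mem_univ x) (Set.mem_univ y) (sub_nonneg.2 hs.2.le) hs.1.le
    (sub_add_cancel 1 s)
  have h2 : (1 - s) • x + s • y = x + s • (y - x) := by module
  rw [h2, smul_eq_mul, smul_eq_mul] at h1
  apply ENNReal.ofReal_le_ofReal
  rw [dist_self_add_right, norm_smul, Real.norm_of_nonneg hs.1.le,
    div_le_div_iff₀ hd (mul_pos hs.1 hd)]
  nlinarith [hs.1]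

/-- **Invariance of the slope under restriction to a flow-invariant subspace.**
Let `f : H → ℝ` be convex continuous and let `H₀` be a closed linear subspace of `H`
invariant under the subgradient flow of `f` (every subgradient curve starting in `H₀`
stays in `H₀`). Then for every `x ∈ H₀` the metric slope of `f` at `x` equals the metric
slope of the restriction `f|_{H₀}` at `x`. -/
theorem slope_eq_slope_of_restriction_of_flow_invariant
    (f : H → ℝ)
    (hconv : ConvexOn ℝ Set.univ f) (hcont : Continuous f)
    (H₀ : Submodule ℝ H) (hclosed : IsClosed (H₀ : Set H))
    (hinv : ∀ x ∈ (H₀ : Set H), ∀ γ : ℝ → H,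
      IsSubgradientCurveR f x γ → ∀ t ≥ (0:ℝ), γ t ∈ (H₀ : Set H)) :
    ∀ x ∈ (H₀ : Set H), mslopeOn f Set.univ x = mslopeOn f (H₀ : Set H) x := by
  intro x hx
  refine le_antisymm ?_ (mslopeOn_mono f (Set.subset_univ _) x)
  obtain ⟨L, -, hxL⟩ := exists_forall_sub_le_mul_norm_sub hconv hcont x
  have hfin : mslopeOn f (H₀ : Set H) x ≠ ∞ :=
    ((mslopeOn_le_ofReal hxL).trans_lt ENNReal.ofReal_lt_top).ne
  have hslope : ∀ y ∈ (H₀ : Set H), f x - f y ≤ (mslopeOn f (H₀ : Set H) x).toReal * ‖y - x‖ :=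
    fun y hy => sub_le_mslopeOn_toReal_mul hconv H₀.convex hx hy hfin
  rw [← ENNReal.ofReal_toReal hfin]
  have hσ : 0 ≤ (mslopeOn f (H₀ : Set H) x).toReal := ENNReal.toReal_nonneg
  set σ := (mslopeOn f (H₀ : Set H) x).toReal
  refine mslopeOn_le_ofReal fun y => ?_
  obtain ⟨γ, hγ, hγ'⟩ := exists_isSubgradientCurveR hconv hcont x
  have key : ∀ t ∈ Set.Ioi (0 : ℝ), f x - f y ≤ σ * ‖y - x‖ + σ ^ 2 * t := by
    intro t ht
    have ht : 0 < t := ht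
    obtain ⟨hevi, henergy⟩ := hγ' t ht.le
    have h1 := hslope (γ t) (hinv x hx γ hγ t ht.le)
    have h2 : ‖γ t - x‖ ≤ σ * t := by
      have : ‖γ t - x‖ ^ 2 ≤ t * (σ * ‖γ t - x‖) := henergy.trans (by gcongr)
      rcases (norm_nonneg (γ t - x)).eq_or_lt with h0 | h0
      · rw [← h0]
        positivity
      · nlinarith
    have h3 := hevi y
    have h4 : ‖γ t - y‖ ^ 2 = ‖γ t - x‖ ^ 2 - 2 * ⟪γ t - x, y - x⟫ + ‖x - y‖ ^ 2 := by
      rw [← sub_sub_sub_cancel_right (γ t) y x, norm_sub_sq_real, norm_sub_rev x y]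
    have h5 := real_inner_le_norm (γ t - x) (y - x)
    have h6 : ‖γ t - x‖ * ‖y - x‖ ≤ σ * t * ‖y - x‖ := by gcongr
    have h7 : t * (f (γ t) - f y) ≤ t * (σ * ‖y - x‖) := by
      nlinarith [sq_nonneg ‖γ t - x‖]
    have h8 := le_of_mul_le_mul_left h7 ht
    nlinarith
  have hT : Tendsto (fun t : ℝ => σ * ‖y - x‖ + σ ^ 2 * t) (nhdsWithin 0 (Set.Ioi 0))
      (nhds (σ * ‖y - x‖ + σ ^ 2 * 0)) :=
    (Continuous.tendsto (by fun_prop) 0).mono_left nhdsWithin_le_nhds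
  rw [mul_zero, add_zero] at hT
  exact ge_of_tendsto hT (Filter.mem_of_superset self_mem_nhdsWithin key)
end

section
/- Let H be a real Hilbert space and f, g : H → ℝ ∪ {+∞} two proper lower semicontinuous convex functions such that: (i) s_f(x) = s_g(x) for all x ∈ H; (ii) p_f = p_g, where p_f and p_g are the Crandall–Pazy directions of f and g; and (iii) the Crandall–Pazy direction is attained, i.e., p_f ∈ ∂f(H). Then there exists a constant c ∈ ℝ such that f(x) = g(x) + c for all x ∈ H. -/
open Set Filter MeasureTheory RealInnerProductSpace
open scoped ENNReal NNReal Classical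

variable {H : Type*} [NormedAddCommGroup H] [InnerProductSpace ℝ H] [CompleteSpace H]

open scoped Topology

set_option linter.unusedSectionVars false

/-- The subdifferential of a real-valued function `F` with effective domain `D`. -/
def domSubdiff (D : Set H) (F : H → ℝ) (x : H) : Set H :=
  {q | x ∈ D ∧ ∀ y ∈ D, F x + ⟪q, y - x⟫ ≤ F y}

/-- A convex function on its effective domain `D`, whose epigraph is closed. -/
structure ClosedConvexOn (D : Set H) (F : H → ℝ) : Prop where
  convexOn : ConvexOn ℝ D F
  isClosed_epigraph : IsClosed {z : H × ℝ | z.1 ∈ D ∧ F z.1 ≤ z.2}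

lemma domSubdiff_monotone {D : Set H} {F : H → ℝ} {x y u v : H}
    (hu : u ∈ domSubdiff D F x) (hv : v ∈ domSubdiff D F y) : 0 ≤ ⟪u - v, x - y⟫ := by
  have h1 := hu.2 y hv.1
  have h2 := hv.2 x hu.1
  rw [← neg_sub x y, inner_neg_right] at h1
  rw [inner_sub_left]
  linarith

namespace ClosedConvexOn

variable {D : Set H} {F : H → ℝ}

lemma exists_quadratic_minimizer (hF : ClosedConvexOn D F) {a q : H}
    (hq : q ∈ domSubdiff D F a) (x : H) {c : ℝ} (hc : 0 < c) :
    ∃ y ∈ D, ∀ z ∈ D, F y + c / 2 * ‖y - x‖ ^ 2 ≤ F z + c / 2 * ‖z - x‖ ^ 2 := by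
  set φ : H → ℝ := fun z => F z + c / 2 * ‖z - x‖ ^ 2 with hφ
  have hbdd : BddBelow (φ '' D) := by
    refine ⟨F a + ⟪q, x - a⟫ - ‖q‖ ^ 2 / (2 * c), ?_⟩
    rintro _ ⟨y, hy, rfl⟩
    have h1 := hq.2 y hy
    have h2 : ⟪q, y - a⟫ = ⟪q, y - x⟫ + ⟪q, x - a⟫ := by
      rw [← inner_add_right]; congr 1; abel
    have h3 : 0 ≤ ‖q + c • (y - x)‖ ^ 2 := by positivity
    rw [norm_add_sq_real, inner_smul_right, norm_smul, Real.norm_of_nonneg hc.le] at h3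
    have h4 : 0 ≤ (‖q‖ ^ 2 + 2 * (c * ⟪q, y - x⟫) + (c * ‖y - x‖) ^ 2) / (2 * c) := by
      positivity
    have h5 : (‖q‖ ^ 2 + 2 * (c * ⟪q, y - x⟫) + (c * ‖y - x‖) ^ 2) / (2 * c)
        = ‖q‖ ^ 2 / (2 * c) + ⟪q, y - x⟫ + c / 2 * ‖y - x‖ ^ 2 := by
      field_simp
    simp only [hφ]
    linarith
  set m := sInf (φ '' D) with hm
  have hle : ∀ z ∈ D, m ≤ φ z := fun z hz => csInf_le hbdd ⟨z, hz, rfl⟩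
  have hex : ∀ n : ℕ, ∃ y ∈ D, φ y < m + 1 / ((n : ℝ) + 1) := by
    intro n
    obtain ⟨_, ⟨y, hy, rfl⟩, h⟩ := exists_lt_of_csInf_lt (s := φ '' D) ⟨_, a, hq.1, rfl⟩
      (show sInf (φ '' D) < m + 1 / ((n : ℝ) + 1) from lt_add_of_pos_right _ (by positivity))
    exact ⟨y, hy, h⟩
  choose y hyD hy using hex
  have hmid : ∀ u ∈ D, ∀ v ∈ D, c / 8 * ‖u - v‖ ^ 2 ≤ (φ u + φ v) / 2 - m := by
    intro u hu v hv
    have h1 : (0 : ℝ) ≤ 1 / 2 := by norm_num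
    have h2 : (1 / 2 : ℝ) + 1 / 2 = 1 := by norm_num
    have h3 := hle _ (hF.convexOn.1 hu hv h1 h1 h2)
    have h4 := hF.convexOn.2 hu hv h1 h1 h2
    have h5 := parallelogram_law_with_norm ℝ (u - x) (v - x)
    have h6 : (1 / 2 : ℝ) • u + (1 / 2 : ℝ) • v - x = (1 / 2 : ℝ) • ((u - x) + (v - x)) := by
      module
    have h7 : u - x - (v - x) = u - v := by abel
    simp only [hφ, smul_eq_mul] at h3 h4 ⊢
    rw [h6, norm_smul] at h3
    rw [h7] at h5
    norm_num at h3
    nlinarith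
  have hlim : Tendsto (fun n : ℕ => 1 / ((n : ℝ) + 1)) atTop (𝓝 0) :=
    tendsto_one_div_add_atTop_nhds_zero_nat
  have hcau : CauchySeq y := by
    refine cauchySeq_of_le_tendsto_0 (fun n : ℕ => Real.sqrt (8 / c * (1 / ((n : ℝ) + 1))))
      (fun n k N hn hk => ?_) ?_
    · rw [dist_eq_norm]
      apply Real.le_sqrt_of_sq_le
      have h1 := hmid _ (hyD n) _ (hyD k)
      have h2 := hy n
      have h3 := hy k
      have h4 : 1 / ((n : ℝ) + 1) ≤ 1 / ((N : ℝ) + 1) := by gcongr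
      have h5 : 1 / ((k : ℝ) + 1) ≤ 1 / ((N : ℝ) + 1) := by gcongr
      have h6 : c / 8 * ‖y n - y k‖ ^ 2 ≤ 1 / ((N : ℝ) + 1) := by linarith
      calc ‖y n - y k‖ ^ 2 = 8 / c * (c / 8 * ‖y n - y k‖ ^ 2) := by field_simp
        _ ≤ _ := by gcongr
    · have := (Real.continuous_sqrt.tendsto _).comp (hlim.const_mul (8 / c))
      simpa [Function.comp_def] using this
  obtain ⟨w, hw⟩ := cauchySeq_tendsto_of_complete hcau
  have hmem : (w, m + 0 - c / 2 * ‖w - x‖ ^ 2) ∈ {z : H × ℝ | z.1 ∈ D ∧ F z.1 ≤ z.2} := by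
    refine hF.isClosed_epigraph.mem_of_tendsto (f := fun n : ℕ =>
      (y n, m + 1 / ((n : ℝ) + 1) - c / 2 * ‖y n - x‖ ^ 2)) (b := atTop)
      (hw.prodMk_nhds ((hlim.const_add m).sub
        ((((hw.sub_const x).norm).pow 2).const_mul (c / 2)))) (Eventually.of_forall fun n => ?_)
    refine ⟨hyD n, ?_⟩
    have := hy n
    simp only [hφ] at this ⊢
    linarith
  refine ⟨w, hmem.1, fun z hz => ?_⟩
  have h1 := hmem.2
  have h2 := hle z hz
  simp only [hφ] at h1 h2
  linarith

/-- Surjectivity of `id + t ∂F` (existence of the proximal point). -/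
lemma exists_resolvent (hF : ClosedConvexOn D F) {a q : H}
    (hq : q ∈ domSubdiff D F a) (x : H) {t : ℝ} (ht : 0 < t) :
    ∃ y v, v ∈ domSubdiff D F y ∧ x = y + t • v := by
  have hc : 0 < t⁻¹ := inv_pos.2 ht
  obtain ⟨y, hyD, hy⟩ := hF.exists_quadratic_minimizer hq x hc
  refine ⟨y, t⁻¹ • (x - y), ⟨hyD, fun z hz => ?_⟩, by
    rw [smul_smul, mul_inv_cancel₀ ht.ne', one_smul]; abel⟩
  set A := F y + ⟪t⁻¹ • (x - y), z - y⟫ - F z with hA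
  set B := t⁻¹ / 2 * ‖z - y‖ ^ 2 with hB
  have key : ∀ s : ℝ, 0 < s → s < 1 → A ≤ s * B := by
    intro s hs hs1
    have h1 : 0 ≤ 1 - s := by linarith
    have h2 : 1 - s + s = 1 := by ring
    have h3 := hy _ (hF.convexOn.1 hyD hz h1 hs.le h2)
    have h4 := hF.convexOn.2 hyD hz h1 hs.le h2
    have h5 : (1 - s) • y + s • z - x = s • (z - y) - (x - y) := by module
    rw [h5, norm_sub_sq_real (s • (z - y)), inner_smul_left, norm_smul,
      Real.norm_of_nonneg hs.le, norm_sub_rev y x, real_inner_comm] at h3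
    simp only [smul_eq_mul, conj_trivial] at h3 h4
    have h6 : s * A ≤ s * (s * B) := by
      rw [hA, hB, inner_smul_left]
      simp only [conj_trivial]
      linarith
    exact le_of_mul_le_mul_left h6 hs
  have hlim : Tendsto (fun s : ℝ => s * B) (𝓝[>] 0) (𝓝 0) := by
    have : Tendsto (fun s : ℝ => s * B) (𝓝 0) (𝓝 (0 * B)) := by
      exact (continuous_id.mul continuous_const).tendsto 0
    rw [zero_mul] at this
    exact this.mono_left nhdsWithin_le_nhds
  have hA0 : A ≤ 0 := by
    refine ge_of_tendsto hlim ?_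
    filter_upwards [Ioo_mem_nhdsGT (zero_lt_one' ℝ)] with s hs using key s hs.1 hs.2
  linarith

/-- Every slope of an affine minorant is a limit of subgradients. -/
lemma mem_closure_range_subdiff (hF : ClosedConvexOn D F) {a q : H}
    (hq : q ∈ domSubdiff D F a) {r : H} {m : ℝ} (hr : ∀ y ∈ D, ⟪r, y⟫ - F y ≤ m) :
    r ∈ closure (⋃ y, domSubdiff D F y) := by
  have hex : ∀ n : ℕ, ∃ v ∈ ⋃ y, domSubdiff D F y,
      ‖v - r‖ ^ 2 ≤ (F a - ⟪r, a⟫ + m) * (1 / ((n : ℝ) + 1)) := by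
    intro n
    have ht : (0 : ℝ) < n + 1 := by positivity
    obtain ⟨y, v, hv, h⟩ := hF.exists_resolvent hq (a + ((n : ℝ) + 1) • r) ht
    refine ⟨v, mem_iUnion.2 ⟨y, hv⟩, ?_⟩
    have h1 := hv.2 a hq.1
    have h2 := hr y hv.1
    have h3 : a - y = ((n : ℝ) + 1) • (v - r) := by
      rw [smul_sub, sub_eq_sub_iff_add_eq_add, h, add_comm]
    have h4 : ⟪v, a - y⟫ = ⟪r, a - y⟫ + ((n : ℝ) + 1) * ‖v - r‖ ^ 2 := by
      have : ⟪v, a - y⟫ = ⟪r, a - y⟫ + ⟪v - r, a - y⟫ := by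
        rw [← inner_add_left]; congr 1; abel
      rw [this]
      congr 1
      rw [h3, inner_smul_right, real_inner_self_eq_norm_sq]
    have h5 : ⟪r, a - y⟫ = ⟪r, a⟫ - ⟪r, y⟫ := inner_sub_right _ _ _
    rw [mul_one_div, le_div_iff₀ ht]
    linarith
  choose v hv hvr using hex
  refine mem_closure_of_tendsto (b := atTop) (f := v) ?_ (Eventually.of_forall hv)
  rw [tendsto_iff_norm_sub_tendsto_zero]
  have hlim : Tendsto (fun n : ℕ => Real.sqrt ((F a - ⟪r, a⟫ + m) * (1 / ((n : ℝ) + 1))))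
      atTop (𝓝 0) := by
    have := (Real.continuous_sqrt.tendsto _).comp
      ((tendsto_one_div_add_atTop_nhds_zero_nat (𝕜 := ℝ)).const_mul (F a - ⟪r, a⟫ + m))
    simpa [Function.comp_def] using this
  exact squeeze_zero (fun _ => norm_nonneg _) (fun n => Real.le_sqrt_of_sq_le (hvr n)) hlim

lemma convex_closure_range_subdiff (hF : ClosedConvexOn D F) {a q : H}
    (hq : q ∈ domSubdiff D F a) : Convex ℝ (closure (⋃ y, domSubdiff D F y)) := by
  set S : Set H := {r | ∃ m, ∀ y ∈ D, ⟪r, y⟫ - F y ≤ m} with hS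
  have hconv : Convex ℝ S := by
    rintro u ⟨m, hm⟩ v ⟨k, hk⟩ s t hs ht hst
    refine ⟨s * m + t * k, fun y hy => ?_⟩
    have h1 := mul_le_mul_of_nonneg_left (hm y hy) hs
    have h2 := mul_le_mul_of_nonneg_left (hk y hy) ht
    rw [inner_add_left, real_inner_smul_left, real_inner_smul_left]
    obtain rfl : t = 1 - s := by linarith
    linarith
  have heq : closure (⋃ y, domSubdiff D F y) = closure S := by
    refine Subset.antisymm (closure_mono ?_) (closure_minimal ?_ isClosed_closure)
    · rintro r hr
      obtain ⟨x, hx⟩ := mem_iUnion.1 hr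
      refine ⟨⟪r, x⟫ - F x, fun y hy => ?_⟩
      have := hx.2 y hy
      rw [inner_sub_right] at this
      linarith
    · rintro r ⟨m, hm⟩
      exact hF.mem_closure_range_subdiff hq hm
  rw [heq]
  exact hconv.closure

/-- The Crandall–Pazy direction `p` satisfies the variational inequality of the projection of
the origin onto the range of the subdifferential. -/
lemma norm_sub_sq_le_of_minimal (hF : ClosedConvexOn D F) {p : H}
    (hp : p ∈ closure (⋃ y, domSubdiff D F y))
    (hmin : ∀ q ∈ closure (⋃ y, domSubdiff D F y), ‖p‖ ≤ ‖q‖) {x v : H}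
    (hv : v ∈ domSubdiff D F x) : ‖v - p‖ ^ 2 ≤ ‖v‖ ^ 2 - ‖p‖ ^ 2 := by
  set K := closure (⋃ y, domSubdiff D F y)
  have hK : Convex ℝ K := hF.convex_closure_range_subdiff hv
  have hvK : v ∈ K := subset_closure (mem_iUnion.2 ⟨x, hv⟩)
  have : Nonempty K := ⟨⟨p, hp⟩⟩
  have h : ‖(0 : H) - p‖ = ⨅ w : K, ‖(0 : H) - w‖ := by
    refine le_antisymm (le_ciInf fun w => ?_)
      (ciInf_le ⟨0, by rintro _ ⟨w, rfl⟩; positivity⟩ (⟨p, hp⟩ : K))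
    simpa using hmin w w.2
  have h1 := (norm_eq_iInf_iff_real_inner_le_zero hK hp).1 h v hvK
  rw [zero_sub, inner_neg_left, inner_sub_right, real_inner_self_eq_norm_sq] at h1
  rw [norm_sub_sq_real, real_inner_comm]
  linarith

/-- If the Crandall–Pazy direction `p` is attained at `a`, it is attained along the half-line
`a - t • p`. -/
lemma mem_subdiff_sub_smul (hF : ClosedConvexOn D F) {p a : H} (hp : p ∈ domSubdiff D F a)
    (hvar : ∀ x, ∀ v ∈ domSubdiff D F x, ‖v - p‖ ^ 2 ≤ ‖v‖ ^ 2 - ‖p‖ ^ 2) {t : ℝ} (ht : 0 ≤ t) :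
    p ∈ domSubdiff D F (a - t • p) := by
  rcases ht.eq_or_lt with rfl | ht
  · simpa using hp
  obtain ⟨y, v, hv, h⟩ := hF.exists_resolvent hp a ht
  have h1 := domSubdiff_monotone hp hv
  have h2 : a - y = t • v := by rw [h]; abel
  rw [h2, inner_smul_right, inner_sub_left, real_inner_self_eq_norm_sq] at h1
  have h3 : 0 ≤ ⟪p, v⟫ - ‖v‖ ^ 2 := nonneg_of_mul_nonneg_right h1 ht
  have h4 := hvar y v hv
  have h5 : ‖v - p‖ ^ 2 = 0 := by
    have h6 := norm_sub_sq_real v p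
    rw [real_inner_comm] at h6
    nlinarith [sq_nonneg ‖v - p‖]
  have h6 : v = p := by simpa [sub_eq_zero] using h5
  subst h6
  have h7 : a - t • v = y := by rw [← h2]; abel
  rwa [h7]

lemma apply_sub_smul_le (hF : ClosedConvexOn D F) {p a : H} (hp : p ∈ domSubdiff D F a)
    (hvar : ∀ x, ∀ v ∈ domSubdiff D F x, ‖v - p‖ ^ 2 ≤ ‖v‖ ^ 2 - ‖p‖ ^ 2) {t : ℝ} (ht : 0 ≤ t) :
    F (a - t • p) ≤ F a - t * ‖p‖ ^ 2 := by
  have h := (hF.mem_subdiff_sub_smul hp hvar ht).2 a hp.1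
  rw [sub_sub_cancel, inner_smul_right, real_inner_self_eq_norm_sq] at h
  linarith

variable {E : Set H} {G : H → ℝ}

/-- Comparison along the proximal iteration with step `t`, at a point of subdifferentiability. -/
lemma sub_le_sub_add_error (hF : ClosedConvexOn D F) (hG : ClosedConvexOn E G) {p a : H}
    (hpF : p ∈ domSubdiff D F a) (hpG : p ∈ domSubdiff E G a)
    (hvarF : ∀ x, ∀ v ∈ domSubdiff D F x, ‖v - p‖ ^ 2 ≤ ‖v‖ ^ 2 - ‖p‖ ^ 2)
    (hvarG : ∀ x, ∀ v ∈ domSubdiff E G x, ‖v - p‖ ^ 2 ≤ ‖v‖ ^ 2 - ‖p‖ ^ 2)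
    (hdom : ∀ x, ∀ v ∈ domSubdiff D F x, ∃ w ∈ domSubdiff E G x, ‖w‖ ≤ ‖v‖)
    {x₀ v₀ : H} (hv₀ : v₀ ∈ domSubdiff D F x₀) {t : ℝ} (ht : 0 < t) {N : ℕ} (hN : 0 < N) :
    G x₀ - F x₀ ≤ G a - F a + t * ‖v₀‖ ^ 2 +
      Real.sqrt ((F x₀ - F a + ‖p‖ * ‖x₀ - a‖) / (N * t)) * ‖x₀ - a‖ := by
  choose J V hV hJ using fun x => hF.exists_resolvent hpF x ht
  let X : ℕ → H × H := fun n => Nat.rec (x₀, v₀) (fun _ z => (J z.1, V z.1)) n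
  set x : ℕ → H := fun n => (X n).1 with hx
  set v : ℕ → H := fun n => (X n).2 with hvdef
  have hv : ∀ n, v n ∈ domSubdiff D F (x n) := by
    intro n
    cases n with
    | zero => exact hv₀
    | succ k => exact hV _
  have hstep : ∀ n, x n = x (n + 1) + t • v (n + 1) := fun n => hJ _
  have hdiff : ∀ n, x n - x (n + 1) = t • v (n + 1) := fun n => by
    rw [sub_eq_iff_eq_add']; exact hstep n
  have hnorm : ∀ n, ‖v (n + 1)‖ ≤ ‖v n‖ := by
    intro n
    have h1 := domSubdiff_monotone (hv n) (hv (n + 1))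
    rw [hdiff, inner_smul_right, inner_sub_left, real_inner_self_eq_norm_sq] at h1
    have h2 := nonneg_of_mul_nonneg_right h1 ht
    have h3 := real_inner_le_norm (v n) (v (n + 1))
    by_contra! h4
    nlinarith [norm_nonneg (v n)]
  have hFstep : ∀ n, F (x (n + 1)) + t * ‖v (n + 1)‖ ^ 2 ≤ F (x n) := by
    intro n
    have h1 := (hv (n + 1)).2 _ (hv n).1
    rwa [hdiff, inner_smul_right, real_inner_self_eq_norm_sq] at h1
  have hGstep : ∀ n, G (x n) - t * ‖v n‖ ^ 2 ≤ G (x (n + 1)) := by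
    intro n
    obtain ⟨w, hw, hwv⟩ := hdom _ _ (hv n)
    obtain ⟨w', hw', -⟩ := hdom _ _ (hv (n + 1))
    have h1 := hw.2 _ hw'.1
    rw [← neg_sub, hdiff, inner_neg_right, inner_smul_right] at h1
    have h2 := real_inner_le_norm w (v (n + 1))
    have h3 : ‖w‖ * ‖v (n + 1)‖ ≤ ‖v n‖ * ‖v n‖ := by
      gcongr
      exact hnorm n
    nlinarith
  have htel : ∀ n, G x₀ - F x₀ ≤ G (x n) - F (x n) + t * (‖v₀‖ ^ 2 - ‖v n‖ ^ 2) := by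
    intro n
    induction n with
    | zero => simp [hx, hvdef, X]
    | succ k ih =>
      have h1 := hFstep k
      have h2 := hGstep k
      linarith
  have hdecr : ∀ n : ℕ, F (x n) + n * t * ‖v n‖ ^ 2 ≤ F x₀ := by
    intro n
    induction n with
    | zero => simp [hx, X]
    | succ k ih =>
      have h1 := hFstep k
      have h2 : (k : ℝ) * t * ‖v (k + 1)‖ ^ 2 ≤ k * t * ‖v k‖ ^ 2 := by
        gcongr
        exact hnorm k
      push_cast
      linarith
  have hw : ∀ n : ℕ, ‖x n - (a - ((n : ℝ) * t) • p)‖ ≤ ‖x₀ - a‖ := by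
    intro n
    induction n with
    | zero => simp [hx, X]
    | succ k ih =>
      refine le_trans ?_ ih
      have h1 := domSubdiff_monotone (hv (k + 1))
        (hF.mem_subdiff_sub_smul hpF hvarF (t := ((k + 1 : ℕ) : ℝ) * t) (by positivity))
      set w := x (k + 1) - (a - (((k + 1 : ℕ) : ℝ) * t) • p) with hw
      have h2 : x k - (a - ((k : ℝ) * t) • p) = w + t • (v (k + 1) - p) := by
        rw [hw, hstep k]
        push_cast
        module
      rw [h2]
      refine le_of_sq_le_sq ?_ (norm_nonneg _)
      rw [norm_add_sq_real, inner_smul_right, real_inner_comm]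
      have : 0 ≤ t * ⟪v (k + 1) - p, w⟫ := mul_nonneg ht.le h1
      nlinarith [sq_nonneg ‖t • (v (k + 1) - p)‖]
  obtain ⟨ξ, hξ, hξv⟩ := hdom _ _ (hv N)
  have hNt : 0 < (N : ℝ) * t := by positivity
  set w := x N - (a - ((N : ℝ) * t) • p) with hwdef
  have hwN : ‖w‖ ≤ ‖x₀ - a‖ := hw N
  have hFN : F a + ⟪p, w⟫ - N * t * ‖p‖ ^ 2 ≤ F (x N) := by
    have h1 := hpF.2 _ (hv N).1
    have h2 : x N - a = w - ((N : ℝ) * t) • p := by rw [hwdef]; abel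
    rw [h2, inner_sub_right, inner_smul_right, real_inner_self_eq_norm_sq] at h1
    linarith
  have hGN : G (x N) ≤ G a - N * t * ‖p‖ ^ 2 + ⟪ξ, w⟫ := by
    have h1 := hξ.2 _ (hG.mem_subdiff_sub_smul hpG hvarG hNt.le).1
    have h2 := hG.apply_sub_smul_le hpG hvarG hNt.le
    rw [← neg_sub (x N), inner_neg_right] at h1
    linarith
  have hξp : ‖ξ - p‖ ≤ Real.sqrt ((F x₀ - F a + ‖p‖ * ‖x₀ - a‖) / (N * t)) := by
    apply Real.le_sqrt_of_sq_le
    have h1 : ‖ξ‖ ^ 2 ≤ ‖v N‖ ^ 2 := by gcongr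
    have h2 : -(‖p‖ * ‖x₀ - a‖) ≤ ⟪p, w⟫ := by
      have := neg_le_of_abs_le (abs_real_inner_le_norm p w)
      have h3 : ‖p‖ * ‖w‖ ≤ ‖p‖ * ‖x₀ - a‖ := by gcongr
      linarith
    rw [le_div_iff₀ hNt]
    have h3 := hdecr N
    have h4 := mul_le_mul_of_nonneg_right ((hvarG _ _ hξ).trans (sub_le_sub_right h1 _)) hNt.le
    linarith
  have hin : ⟪ξ, w⟫ - ⟪p, w⟫ ≤
      Real.sqrt ((F x₀ - F a + ‖p‖ * ‖x₀ - a‖) / (N * t)) * ‖x₀ - a‖ := by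
    rw [← inner_sub_left]
    exact (real_inner_le_norm _ _).trans (by gcongr)
  have h1 := htel N
  have h2 : 0 ≤ t * ‖v N‖ ^ 2 := by positivity
  linarith

lemma sub_le_sub_of_subdiff (hF : ClosedConvexOn D F) (hG : ClosedConvexOn E G) {p a : H}
    (hpF : p ∈ domSubdiff D F a) (hpG : p ∈ domSubdiff E G a)
    (hvarF : ∀ x, ∀ v ∈ domSubdiff D F x, ‖v - p‖ ^ 2 ≤ ‖v‖ ^ 2 - ‖p‖ ^ 2)
    (hvarG : ∀ x, ∀ v ∈ domSubdiff E G x, ‖v - p‖ ^ 2 ≤ ‖v‖ ^ 2 - ‖p‖ ^ 2)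
    (hdom : ∀ x, ∀ v ∈ domSubdiff D F x, ∃ w ∈ domSubdiff E G x, ‖w‖ ≤ ‖v‖)
    {x v : H} (hv : v ∈ domSubdiff D F x) : G x - F x ≤ G a - F a := by
  set C := F x - F a + ‖p‖ * ‖x - a‖
  have hlim := tendsto_one_div_add_atTop_nhds_zero_nat (𝕜 := ℝ)
  have h1 : Tendsto (fun n : ℕ => G a - F a + 1 / ((n : ℝ) + 1) * ‖v‖ ^ 2 +
      Real.sqrt (C * (1 / ((n : ℝ) + 1))) * ‖x - a‖) atTop (𝓝 (G a - F a)) := by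
    have := ((hlim.mul_const (‖v‖ ^ 2)).const_add (G a - F a)).add
      (((Real.continuous_sqrt.tendsto _).comp (hlim.const_mul C)).mul_const ‖x - a‖)
    simpa [Function.comp_def] using this
  refine ge_of_tendsto' h1 fun n => ?_
  have h2 := hF.sub_le_sub_add_error hG hpF hpG hvarF hvarG hdom hv
    (t := 1 / ((n : ℝ) + 1)) (by positivity) (N := (n + 1) ^ 2) (by positivity)
  have h3 : (((n + 1) ^ 2 : ℕ) : ℝ) * (1 / ((n : ℝ) + 1)) = (n : ℝ) + 1 := by
    push_cast
    field_simp
  rwa [h3, div_eq_mul_one_div (F x - F a + ‖p‖ * ‖x - a‖)] at h2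

/-- Domination of the slopes of `G` by those of `F` gives domination of `G` by `F`, up to
normalization at a point where the common Crandall–Pazy direction is attained. -/
lemma apply_sub_le_apply_sub (hF : ClosedConvexOn D F) (hG : ClosedConvexOn E G) {p a : H}
    (hpF : p ∈ domSubdiff D F a) (hpG : p ∈ domSubdiff E G a)
    (hvarF : ∀ x, ∀ v ∈ domSubdiff D F x, ‖v - p‖ ^ 2 ≤ ‖v‖ ^ 2 - ‖p‖ ^ 2)
    (hvarG : ∀ x, ∀ v ∈ domSubdiff E G x, ‖v - p‖ ^ 2 ≤ ‖v‖ ^ 2 - ‖p‖ ^ 2)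
    (hdom : ∀ x, ∀ v ∈ domSubdiff D F x, ∃ w ∈ domSubdiff E G x, ‖w‖ ≤ ‖v‖)
    {x : H} (hx : x ∈ D) : x ∈ E ∧ G x ≤ F x + (G a - F a) := by
  set C := F x - F a + ‖p‖ * ‖x - a‖
  have hex : ∀ n : ℕ, ∃ y, y ∈ E ∧ G y ≤ F x + (G a - F a) ∧
      ‖y - x‖ ^ 2 ≤ 2 * C * (1 / ((n : ℝ) + 1)) + ‖p‖ ^ 2 * (1 / ((n : ℝ) + 1)) ^ 2 := by
    intro n
    set t := 1 / ((n : ℝ) + 1)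
    have ht : 0 < t := by positivity
    obtain ⟨y, v, hv, h⟩ := hF.exists_resolvent hpF x ht
    obtain ⟨w, hw, -⟩ := hdom _ _ hv
    have h1 := hF.sub_le_sub_of_subdiff hG hpF hpG hvarF hvarG hdom hv
    have h2 := hv.2 x hx
    have h3 : x - y = t • v := by rw [h]; abel
    rw [h3, inner_smul_right, real_inner_self_eq_norm_sq] at h2
    have h4 : 0 ≤ t * ‖v‖ ^ 2 := by positivity
    refine ⟨y, hw.1, by linarith, ?_⟩
    have h5 := hpF.2 y hv.1
    have h6 : y - a = (x - a) - t • v := by rw [h]; abel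
    rw [h6, inner_sub_right, inner_smul_right] at h5
    have h7 := neg_le_of_abs_le (abs_real_inner_le_norm p (x - a))
    have h8 := real_inner_le_norm p v
    have h9 : t * ‖v‖ ^ 2 ≤ C + t * (‖p‖ * ‖v‖) := by
      have := mul_le_mul_of_nonneg_left h8 ht.le
      linarith
    rw [norm_sub_rev, h3, norm_smul, Real.norm_of_nonneg ht.le]
    have h10 := mul_le_mul_of_nonneg_left h9 ht.le
    nlinarith [sq_nonneg (t * ‖p‖ - t * ‖v‖)]
  choose y hyE hyG hyx using hex
  have hlim := tendsto_one_div_add_atTop_nhds_zero_nat (𝕜 := ℝ)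
  have hy : Tendsto y atTop (𝓝 x) := by
    rw [tendsto_iff_norm_sub_tendsto_zero]
    refine squeeze_zero (fun _ => norm_nonneg _) (fun n => Real.le_sqrt_of_sq_le (hyx n)) ?_
    have := (Real.continuous_sqrt.tendsto _).comp
      ((hlim.const_mul (2 * C)).add ((hlim.pow 2).const_mul (‖p‖ ^ 2)))
    simpa [Function.comp_def] using this
  have hmem : (x, F x + (G a - F a)) ∈ {z : H × ℝ | z.1 ∈ E ∧ G z.1 ≤ z.2} :=
    hG.isClosed_epigraph.mem_of_tendsto (f := fun n => (y n, F x + (G a - F a)))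
      (hy.prodMk_nhds tendsto_const_nhds) (Eventually.of_forall fun n => ⟨hyE n, hyG n⟩)
  exact hmem

end ClosedConvexOn

section EReal

variable {f : H → EReal}

lemma coe_toReal_of_mem {α : Type*} {f : α → EReal} (hbot : ∀ y, f y ≠ ⊥) {x : α}
    (hx : x ∈ {y | f y ≠ ⊤}) :
    ((f x).toReal : EReal) = f x :=
  EReal.coe_toReal hx (hbot x)

lemma subdiffE_eq_domSubdiff (hproper : ∃ y, f y ≠ ⊤) (hbot : ∀ y, f y ≠ ⊥) (x : H) :
    SubdiffE f x = domSubdiff {y | f y ≠ ⊤} (fun y => (f y).toReal) x := by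
  ext q
  constructor
  · intro hq
    have hx : f x ≠ ⊤ := by
      intro h
      obtain ⟨y, hy⟩ := hproper
      have := hq y
      rw [h, EReal.top_add_coe, top_le_iff] at this
      exact hy this
    refine ⟨hx, fun y hy => ?_⟩
    have := hq y
    rw [← coe_toReal_of_mem hbot hx, ← coe_toReal_of_mem hbot hy] at this
    exact_mod_cast this
  · rintro ⟨hx, h⟩ y
    by_cases hy : f y = ⊤
    · rw [hy]; exact le_top
    · rw [← coe_toReal_of_mem hbot hx, ← coe_toReal_of_mem hbot hy]
      exact_mod_cast h y hy

lemma closedConvexOn_of_convexE (hbot : ∀ y, f y ≠ ⊥) (hlsc : LowerSemicontinuous f)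
    (hconv : ConvexE f) : ClosedConvexOn {y | f y ≠ ⊤} (fun y => (f y).toReal) := by
  have key : ∀ x ∈ {y | f y ≠ ⊤}, ∀ y ∈ {y | f y ≠ ⊤}, ∀ a b : ℝ, 0 ≤ a → 0 ≤ b → a + b = 1 →
      f (a • x + b • y) ≤ ((a * (f x).toReal + b * (f y).toReal : ℝ) : EReal) := by
    intro x hx y hy a b ha hb hab
    have := hconv x y a b ha hb hab
    rw [← coe_toReal_of_mem hbot hx, ← coe_toReal_of_mem hbot hy] at this
    exact_mod_cast this
  refine ⟨⟨fun x hx y hy a b ha hb hab => ?_, fun x hx y hy a b ha hb hab => ?_⟩, ?_⟩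
  · exact ((key x hx y hy a b ha hb hab).trans_lt (EReal.coe_lt_top _)).ne
  · have h := key x hx y hy a b ha hb hab
    have h1 : a • x + b • y ∈ {y | f y ≠ ⊤} := (h.trans_lt (EReal.coe_lt_top _)).ne
    rw [← coe_toReal_of_mem hbot h1] at h
    exact_mod_cast h
  · have h1 : {z : H × ℝ | z.1 ∈ {y | f y ≠ ⊤} ∧ (f z.1).toReal ≤ z.2} =
        (fun z : H × ℝ => (z.1, (z.2 : EReal))) ⁻¹' {z : H × EReal | f z.1 ≤ z.2} := by
      ext z
      constructor
      · rintro ⟨h1, h2⟩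
        change f z.1 ≤ z.2
        rw [← coe_toReal_of_mem hbot h1]
        exact_mod_cast h2
      · intro h
        change f z.1 ≤ z.2 at h
        have h1 : z.1 ∈ {y | f y ≠ ⊤} := (h.trans_lt (EReal.coe_lt_top _)).ne
        refine ⟨h1, ?_⟩
        rw [← coe_toReal_of_mem hbot h1] at h
        exact_mod_cast h
    rw [h1]
    exact hlsc.isClosed_epigraph.preimage
      (continuous_fst.prodMk (continuous_coe_real_ereal.comp continuous_snd))

end EReal

lemma isClosed_domSubdiff (D : Set H) (F : H → ℝ) (x : H) : IsClosed (domSubdiff D F x) := by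
  have h : domSubdiff D F x = {_q | x ∈ D} ∩ ⋂ y ∈ D, {q | F x + ⟪q, y - x⟫ ≤ F y} := by
    ext q
    simp [domSubdiff]
  rw [h]
  exact isClosed_const.inter (isClosed_biInter fun y _ =>
    isClosed_le (by fun_prop) continuous_const)

lemma convex_domSubdiff (D : Set H) (F : H → ℝ) (x : H) : Convex ℝ (domSubdiff D F x) := by
  rintro u ⟨hx, hu⟩ v ⟨-, hv⟩ s t hs ht hst
  refine ⟨hx, fun y hy => ?_⟩
  have h1 := mul_le_mul_of_nonneg_left (hu y hy) hs
  have h2 := mul_le_mul_of_nonneg_left (hv y hy) ht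
  rw [inner_add_left, real_inner_smul_left, real_inner_smul_left]
  obtain rfl : t = 1 - s := by linarith
  linarith

/-- A nonempty closed convex set contains an element of minimal norm. -/
lemma exists_minimal_norm {K : Set H} (hne : K.Nonempty) (hcl : IsClosed K) (hK : Convex ℝ K) :
    ∃ w ∈ K, ∀ u ∈ K, ‖w‖ ≤ ‖u‖ := by
  obtain ⟨w, hw, h⟩ := exists_norm_eq_iInf_of_complete_convex hne hcl.isComplete hK 0
  refine ⟨w, hw, fun u hu => ?_⟩
  have h1 : (⨅ w : K, ‖(0 : H) - w‖) ≤ ‖(0 : H) - (⟨u, hu⟩ : K)‖ :=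
    ciInf_le ⟨0, by rintro _ ⟨w, rfl⟩; positivity⟩ _
  rw [← h] at h1
  simpa using h1

lemma exists_norm_le_of_slopeE_le {f g : H → EReal} (hproper : ∃ y, g y ≠ ⊤)
    (hbot : ∀ y, g y ≠ ⊥) {x v : H} (hslope : slopeE g x ≤ slopeE f x) (hv : v ∈ SubdiffE f x) :
    ∃ w ∈ SubdiffE g x, ‖w‖ ≤ ‖v‖ := by
  have h1 : slopeE g x ≤ (‖v‖₊ : ℝ≥0∞) := hslope.trans (iInf₂_le v hv)
  have hne : (SubdiffE g x).Nonempty := by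
    by_contra hemp
    rw [not_nonempty_iff_eq_empty] at hemp
    simp [slopeE, hemp] at h1
  obtain ⟨w, hw, hmin⟩ := exists_minimal_norm hne
    (by rw [subdiffE_eq_domSubdiff hproper hbot]; exact isClosed_domSubdiff _ _ _)
    (by rw [subdiffE_eq_domSubdiff hproper hbot]; exact convex_domSubdiff _ _ _)
  refine ⟨w, hw, ?_⟩
  have h2 : (‖w‖₊ : ℝ≥0∞) ≤ slopeE g x := le_iInf₂ fun u hu => by exact_mod_cast hmin u hu
  exact_mod_cast h2.trans h1

/-- **Determination of convex functions when the Crandall–Pazy direction is attained.**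
Let `f, g : H → ℝ ∪ {+∞}` be proper lsc convex functions with the same slope at every
point and the same Crandall–Pazy direction `pf` (the element of minimal norm of the
closure of the range of the subdifferential). If moreover `pf` is attained, i.e.
`pf ∈ ∂f(H)`, then `f` and `g` are equal up to an additive constant. -/
theorem determination_nonsmooth_CP_attained
    (f g : H → EReal)
    (hfproper : ∃ y, f y ≠ ⊤) (hfnobot : ∀ y, f y ≠ ⊥)
    (hflsc : LowerSemicontinuous f) (hfconv : ConvexE f)
    (hgproper : ∃ y, g y ≠ ⊤) (hgnobot : ∀ y, g y ≠ ⊥)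
    (hglsc : LowerSemicontinuous g) (hgconv : ConvexE g)
    (hslope : ∀ x, slopeE f x = slopeE g x)
    (pf : H)
    (hpf : pf ∈ closure (⋃ y, SubdiffE f y) ∧
      ∀ q ∈ closure (⋃ y, SubdiffE f y), ‖pf‖ ≤ ‖q‖)
    (hpg : pf ∈ closure (⋃ y, SubdiffE g y) ∧
      ∀ q ∈ closure (⋃ y, SubdiffE g y), ‖pf‖ ≤ ‖q‖)
    (hattained : pf ∈ ⋃ y, SubdiffE f y) :
    ∃ c : ℝ, ∀ x, f x = g x + (c : EReal) := by
  set D := {y | f y ≠ ⊤}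
  set E := {y | g y ≠ ⊤}
  set F : H → ℝ := fun y => (f y).toReal
  set G : H → ℝ := fun y => (g y).toReal
  have hF : ClosedConvexOn D F := closedConvexOn_of_convexE hfnobot hflsc hfconv
  have hG : ClosedConvexOn E G := closedConvexOn_of_convexE hgnobot hglsc hgconv
  have hSf : ∀ x, SubdiffE f x = domSubdiff D F x := subdiffE_eq_domSubdiff hfproper hfnobot
  have hSg : ∀ x, SubdiffE g x = domSubdiff E G x := subdiffE_eq_domSubdiff hgproper hgnobot
  have hfg : ∀ x, ∀ v ∈ domSubdiff D F x, ∃ w ∈ domSubdiff E G x, ‖w‖ ≤ ‖v‖ := by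
    intro x v hv
    rw [← hSf] at hv
    rw [← hSg]
    exact exists_norm_le_of_slopeE_le hgproper hgnobot (hslope x).ge hv
  have hgf : ∀ x, ∀ v ∈ domSubdiff E G x, ∃ w ∈ domSubdiff D F x, ‖w‖ ≤ ‖v‖ := by
    intro x v hv
    rw [← hSg] at hv
    rw [← hSf]
    exact exists_norm_le_of_slopeE_le hfproper hfnobot (hslope x).le hv
  simp only [hSf] at hpf hattained
  simp only [hSg] at hpg
  have hvarF : ∀ x, ∀ v ∈ domSubdiff D F x, ‖v - pf‖ ^ 2 ≤ ‖v‖ ^ 2 - ‖pf‖ ^ 2 :=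
    fun x v hv => hF.norm_sub_sq_le_of_minimal hpf.1 hpf.2 hv
  have hvarG : ∀ x, ∀ v ∈ domSubdiff E G x, ‖v - pf‖ ^ 2 ≤ ‖v‖ ^ 2 - ‖pf‖ ^ 2 :=
    fun x v hv => hG.norm_sub_sq_le_of_minimal hpg.1 hpg.2 hv
  obtain ⟨a, hpF⟩ := mem_iUnion.1 hattained
  have hpG : pf ∈ domSubdiff E G a := by
    obtain ⟨w, hw, hwp⟩ := hfg a pf hpF
    have h1 := hvarG a w hw
    have h2 : ‖w‖ ^ 2 ≤ ‖pf‖ ^ 2 := by gcongr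
    have h3 : ‖w - pf‖ ^ 2 = 0 := le_antisymm (by linarith) (sq_nonneg _)
    have h4 : w = pf := by simpa [sub_eq_zero] using h3
    rwa [← h4]
  refine ⟨F a - G a, fun x => ?_⟩
  by_cases hx : x ∈ D
  · obtain ⟨hxE, h1⟩ := hF.apply_sub_le_apply_sub hG hpF hpG hvarF hvarG hfg hx
    obtain ⟨-, h2⟩ := hG.apply_sub_le_apply_sub hF hpG hpF hvarG hvarF hgf hxE
    rw [← coe_toReal_of_mem hfnobot hx, ← coe_toReal_of_mem hgnobot hxE, ← EReal.coe_add]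
    exact congrArg _ (le_antisymm h2 (by linarith))
  · have hxE : x ∉ E := fun hxE =>
      hx (hG.apply_sub_le_apply_sub hF hpG hpF hvarG hvarF hgf hxE).1
    have h1 : f x = ⊤ := not_not.1 hx
    have h2 : g x = ⊤ := not_not.1 hxE
    rw [h1, h2, EReal.top_add_coe]
end
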